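/- Let u₀ be real, let V : ℝ → ℝ be continuously differentiable on [u₀,∞), and suppose there is u₁ ≥ u₀ such that V is strictly increasing and convex on [u₁,∞). Fix α with 0 ≤ α < 2π. Then there exist constants T₁ and C > 0 such that for every T ≥ T₁: (a) there is a unique u_T ≥ u₀ with V(u_T) = T and V(u) < T for u₀ ≤ u < u_T; and (b) the set S(α, u₀, V) ∩ (−∞, T) is finite and its cardinality N(T) satisfies |N(T) − (1/π)·∫_{u₀}^{u_T} √(T − V(u)) du| ≤ C. -/

import Mathlib

open MeasureTheory in
/-- The set of eigenvalues of the Schrödinger operator `-d²/du² + V` on `[u₀,∞)`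
with boundary condition `cos α · ψ(u₀) + sin α · ψ'(u₀) = 0`. -/
def evSet (α u₀ : ℝ) (V : ℝ → ℝ) : Set ℝ :=
  {E | ∃ ψ : ℝ → ℝ,
    (∀ u, DifferentiableAt ℝ ψ u) ∧ (∀ u, DifferentiableAt ℝ (deriv ψ) u) ∧
    (∃ u, u₀ ≤ u ∧ ψ u ≠ 0) ∧
    IntegrableOn (fun u => (ψ u)^2) (Set.Ici u₀) ∧
    (∀ u, u₀ ≤ u → -(deriv (deriv ψ) u) + V u * ψ u = E * ψ u) ∧
    Real.cos α * ψ u₀ + Real.sin α * deriv ψ u₀ = 0}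

section Helpers

open Set Filter Topology MeasureTheory


/-- Right-hand side of the Prüfer angle equation. -/
noncomputable def prF (W : ℝ → ℝ) (E u x : ℝ) : ℝ := 1 + (E - W u - 1) * Real.sin x ^ 2

lemma sin_sq_lip (x y : ℝ) : |Real.sin x ^ 2 - Real.sin y ^ 2| ≤ |x - y| := by
  have h : Real.sin x ^ 2 - Real.sin y ^ 2 = Real.sin (x - y) * Real.sin (x + y) := by
    rw [Real.sin_sub, Real.sin_add]
    have h1 := Real.sin_sq_add_cos_sq x
    have h2 := Real.sin_sq_add_cos_sq y
    have h3 : Real.cos x ^ 2 = 1 - Real.sin x ^ 2 := by linarith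
    have h4 : Real.cos y ^ 2 = 1 - Real.sin y ^ 2 := by linarith
    ring_nf
    rw [h3, h4]; ring
  rw [h, abs_mul]
  calc |Real.sin (x - y)| * |Real.sin (x + y)| ≤ |x - y| * 1 := by
        exact mul_le_mul Real.abs_sin_le_abs (Real.abs_sin_le_one _) (abs_nonneg _) (abs_nonneg _)
    _ = _ := mul_one _

lemma prF_lip (W : ℝ → ℝ) (E u x y K : ℝ) (hK : |E - W u - 1| ≤ K) :
    |prF W E u x - prF W E u y| ≤ K * |x - y| := by
  have : prF W E u x - prF W E u y = (E - W u - 1) * (Real.sin x ^ 2 - Real.sin y ^ 2) := by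
    unfold prF; ring
  rw [this, abs_mul]
  have hK0 : 0 ≤ K := (abs_nonneg _).trans hK
  exact mul_le_mul hK (sin_sq_lip x y) (abs_nonneg _) hK0

lemma prF_lipW (W : ℝ → ℝ) (E u : ℝ) (K : NNReal) (hK : |E - W u - 1| ≤ K) :
    LipschitzWith K (prF W E u) := by
  apply LipschitzWith.of_dist_le_mul
  intro x y
  rw [Real.dist_eq, Real.dist_eq]
  exact prF_lip W E u x y K hK

lemma exists_K (W : ℝ → ℝ) (hW : Continuous W) (E a b : ℝ) :
    ∃ K : NNReal, ∀ u ∈ Icc a b, |E - W u - 1| ≤ K := by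
  have hc : ContinuousOn (fun u => E - W u - 1) (Icc a b) := by fun_prop
  obtain ⟨C, hC⟩ := isCompact_Icc.exists_bound_of_continuousOn hc
  refine ⟨Real.toNNReal C, fun u hu => ?_⟩
  exact (hC u hu).trans (Real.le_coe_toNNReal C)

lemma exists_theta_local (W : ℝ → ℝ) (hW : Continuous W) (E u₀ x₀ : ℝ) (n : ℝ) (hn : 0 < n) :
    ∃ θ : ℝ → ℝ, θ u₀ = x₀ ∧ ∀ u ∈ Ioo (u₀ - n) (u₀ + n), HasDerivAt θ (prF W E u (θ u)) u := by
  obtain ⟨K, hK⟩ := exists_K W hW E (u₀ - n) (u₀ + n)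
  have hpl : IsPicardLindelof (prF W E) (tmin := u₀ - n) (tmax := u₀ + n)
      ⟨u₀, by constructor <;> linarith⟩ x₀ ((1 + K) * ⟨n, hn.le⟩) 0 (1 + K) K := by
    constructor
    · intro t ht
      exact (prF_lipW W E t K (hK t ht)).lipschitzOnWith
    · intro x _
      unfold prF
      fun_prop
    · intro t ht x _
      unfold prF
      rw [Real.norm_eq_abs]
      push_cast
      calc |1 + (E - W t - 1) * Real.sin x ^ 2| ≤ |(1:ℝ)| + |(E - W t - 1) * Real.sin x ^ 2| :=
            abs_add_le _ _
        _ ≤ 1 + K * 1 := by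
            rw [abs_one, abs_mul]
            gcongr
            · exact hK t ht
            · rw [abs_pow, sq_abs]; exact Real.sin_sq_le_one x
        _ = _ := by ring
    · simp only [add_sub_cancel_left, sub_sub_cancel, max_self, NNReal.coe_zero, sub_zero]
      exact le_rfl
  obtain ⟨θ, h0, h1⟩ := hpl.exists_eq_forall_mem_Icc_hasDerivWithinAt₀
  refine ⟨θ, h0, fun u hu => ?_⟩
  exact (h1 u (Ioo_subset_Icc_self hu)).hasDerivAt (Icc_mem_nhds hu.1 hu.2)

lemma exists_theta (W : ℝ → ℝ) (hW : Continuous W) (E u₀ x₀ : ℝ) :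
    ∃ θ : ℝ → ℝ, θ u₀ = x₀ ∧ ∀ u, HasDerivAt θ (prF W E u (θ u)) u := by
  have H := fun n : ℕ => exists_theta_local W hW E u₀ x₀ (n + 1) (by positivity)
  choose f hf0 hf using H
  have huniq : ∀ m n : ℕ, m ≤ n → EqOn (f m) (f n) (Ioo (u₀ - (m+1)) (u₀ + (m+1))) := by
    intro m n hmn
    obtain ⟨K, hK⟩ := exists_K W hW E (u₀ - (m+1)) (u₀ + (m+1))
    have hmn' : (m:ℝ) ≤ n := by exact_mod_cast hmn
    have hm : (0:ℝ) ≤ m := by positivity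
    apply ODE_solution_unique_of_mem_Ioo (v := prF W E) (s := fun _ => univ) (K := K) (t₀ := u₀)
    · intro t ht
      exact (prF_lipW W E t K (hK t (Ioo_subset_Icc_self ht))).lipschitzOnWith
    · constructor <;> linarith
    · exact fun t ht => ⟨hf m t ht, trivial⟩
    · exact fun t ht => ⟨hf n t ⟨by linarith [ht.1], by linarith [ht.2]⟩, trivial⟩
    · rw [hf0, hf0]
  have hkey : ∀ (n : ℕ) (u : ℝ), u ∈ Ioo (u₀ - (n+1)) (u₀ + (n+1)) →
      f ⌈|u - u₀|⌉₊ u = f n u := by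
    intro n u hu
    have h2 : u ∈ Ioo (u₀ - ((⌈|u - u₀|⌉₊:ℝ)+1)) (u₀ + ((⌈|u - u₀|⌉₊:ℝ)+1)) := by
      have := Nat.le_ceil |u - u₀|
      have := abs_le.mp this
      constructor <;> linarith [this.1, this.2]
    rcases le_total ⌈|u - u₀|⌉₊ n with h | h
    · exact huniq _ _ h h2
    · exact (huniq _ _ h hu).symm
  refine ⟨fun u => f ⌈|u - u₀|⌉₊ u, hf0 _, fun u => ?_⟩
  obtain ⟨n, hn⟩ := exists_nat_ge |u - u₀|
  have hu : u ∈ Ioo (u₀ - ((n:ℝ)+1)) (u₀ + (n+1)) := by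
    have := abs_le.mp hn
    constructor <;> linarith [this.1, this.2]
  have h3 := hf n u hu
  simp only [hkey n u hu]
  apply h3.congr_of_eventuallyEq
  filter_upwards [isOpen_Ioo.mem_nhds hu] with x hx
  exact hkey n x hx

/-- Comparison of sub- and supersolutions. -/
lemma prF_compare (W : ℝ → ℝ) (hW : Continuous W) (E a b : ℝ) (hab : a ≤ b)
    (f g f' g' : ℝ → ℝ) (hf : ∀ u ∈ Icc a b, HasDerivAt f (f' u) u)
    (hg : ∀ u ∈ Icc a b, HasDerivAt g (g' u) u)
    (hf' : ∀ u ∈ Icc a b, f' u ≤ prF W E u (f u))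
    (hg' : ∀ u ∈ Icc a b, prF W E u (g u) ≤ g' u) (h0 : f a ≤ g a) : f b ≤ g b := by
  by_contra hcon
  push Not at hcon
  obtain ⟨K, hK⟩ := exists_K W hW E a b
  have hcf : ContinuousOn f (Icc a b) := fun u hu => (hf u hu).continuousAt.continuousWithinAt
  have hcg : ContinuousOn g (Icc a b) := fun u hu => (hg u hu).continuousAt.continuousWithinAt
  have hcl : IsCompact {u ∈ Icc a b | f u ≤ g u} := by
    apply isCompact_Icc.of_isClosed_subset _ (fun u hu => hu.1)
    exact isClosed_Icc.isClosed_le hcf hcg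
  obtain ⟨c, ⟨hcI, hc⟩, hcmax⟩ := hcl.exists_isGreatest ⟨a, left_mem_Icc.mpr hab, h0⟩
  have hpos : ∀ u ∈ Ioc c b, g u < f u := by
    intro u hu
    by_contra hn
    push Not at hn
    have := hcmax ⟨⟨hcI.1.trans hu.1.le, hu.2⟩, hn⟩
    exact absurd hu.1 (not_lt.mpr this)
  have hanti : AntitoneOn (fun u => (f u - g u) * Real.exp (-K * u)) (Icc c b) := by
    have hd : ∀ u ∈ Icc c b, HasDerivAt (fun u => (f u - g u) * Real.exp (-K * u))
        ((f' u - g' u) * Real.exp (-K * u) + (f u - g u) * (Real.exp (-K * u) * (-K * 1))) u := by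
      intro u hu
      have hu' : u ∈ Icc a b := ⟨hcI.1.trans hu.1, hu.2⟩
      exact ((hf u hu').sub (hg u hu')).mul (((hasDerivAt_id u).const_mul (-(K:ℝ))).exp)
    apply antitoneOn_of_deriv_nonpos (convex_Icc c b)
    · exact fun u hu => (hd u hu).continuousAt.continuousWithinAt
    · exact fun u hu => (hd u (interior_subset hu)).differentiableAt.differentiableWithinAt
    · intro u hu
      rw [interior_Icc] at hu
      have huI : u ∈ Icc c b := Ioo_subset_Icc_self hu
      have hu' : u ∈ Icc a b := ⟨hcI.1.trans hu.1.le, hu.2.le⟩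
      rw [(hd u huI).deriv]
      have h1 := hpos u ⟨hu.1, hu.2.le⟩
      have h2 := abs_le.mp (prF_lip W E u (f u) (g u) K (hK u hu'))
      rw [abs_of_pos (by linarith)] at h2
      have h3 := hf' u hu'
      have h4 := hg' u hu'
      have h5 : (f' u - g' u) - K * (f u - g u) ≤ 0 := by linarith [h2.2]
      have h6 := Real.exp_pos (-K * u)
      have : (f' u - g' u) * Real.exp (-K * u) + (f u - g u) * (Real.exp (-K * u) * (-K * 1))
        = ((f' u - g' u) - K * (f u - g u)) * Real.exp (-K * u) := by ring
      rw [this]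
      exact mul_nonpos_of_nonpos_of_nonneg h5 h6.le
  have h7 := hanti (left_mem_Icc.mpr hcI.2) (right_mem_Icc.mpr hcI.2) hcI.2
  simp only at h7
  have h8 : (f c - g c) * Real.exp (-K * c) ≤ 0 :=
    mul_nonpos_of_nonpos_of_nonneg (by linarith) (Real.exp_pos _).le
  have h9 : 0 < (f b - g b) * Real.exp (-K * b) := mul_pos (by linarith) (Real.exp_pos _)
  linarith

lemma sin_sq_eq_zero_of_int (k : ℤ) : Real.sin (k * Real.pi) ^ 2 = 0 := by
  rw [Real.sin_int_mul_pi]; norm_num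

lemma sin_sq_eq_one_of_int (k : ℤ) : Real.sin (k * Real.pi + Real.pi / 2) ^ 2 = 1 := by
  rw [Real.sin_add_pi_div_two]
  have := Real.sin_sq_add_cos_sq (k * Real.pi)
  rw [Real.sin_int_mul_pi] at this
  linarith

/-- the angle never crosses a multiple of `π` downwards. -/
lemma theta_lower (W : ℝ → ℝ) (hW : Continuous W) (E a b : ℝ) (hab : a ≤ b) (θ : ℝ → ℝ)
    (hθ : ∀ u, HasDerivAt θ (prF W E u (θ u)) u) (k : ℤ) (h0 : k * Real.pi ≤ θ a) :
    k * Real.pi ≤ θ b := by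
  apply prF_compare W hW E a b hab (fun _ => k * Real.pi) θ (fun _ => 0) _
    (fun u _ => hasDerivAt_const _ _) (fun u _ => hθ u) _ (fun u _ => le_rfl) h0
  intro u _
  unfold prF
  rw [sin_sq_eq_zero_of_int]; norm_num

lemma theta_upper (W : ℝ → ℝ) (hW : Continuous W) (E a b : ℝ) (hab : a ≤ b) (θ : ℝ → ℝ)
    (hθ : ∀ u, HasDerivAt θ (prF W E u (θ u)) u) (hE : ∀ u ∈ Icc a b, E ≤ W u)
    (k : ℤ) (h0 : θ a ≤ k * Real.pi + Real.pi / 2) :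
    θ b ≤ k * Real.pi + Real.pi / 2 := by
  apply prF_compare W hW E a b hab θ (fun _ => k * Real.pi + Real.pi / 2) _ (fun _ => 0)
    (fun u _ => hθ u) (fun u _ => hasDerivAt_const _ _) (fun u _ => le_rfl) _ h0
  intro u hu
  unfold prF
  rw [sin_sq_eq_one_of_int]
  linarith [hE u hu]

lemma theta_mono (W : ℝ → ℝ) (hW : Continuous W) (E E' a b : ℝ) (hab : a ≤ b) (hE : E ≤ E')
    (θ θ' : ℝ → ℝ)
    (hθ : ∀ u, HasDerivAt θ (prF W E u (θ u)) u)
    (hθ' : ∀ u, HasDerivAt θ' (prF W E' u (θ' u)) u) (h0 : θ a ≤ θ' a) : θ b ≤ θ' b := by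
  apply prF_compare W hW E a b hab θ θ' _ _ (fun u _ => hθ u) (fun u _ => hθ' u)
    (fun u _ => le_rfl) _ h0
  intro u _
  unfold prF
  nlinarith [sq_nonneg (Real.sin (θ' u))]

lemma theta_cont (W : ℝ → ℝ) (hW : Continuous W) (u₀ x₀ b : ℝ) (hb : u₀ ≤ b)
    (θ : ℝ → ℝ → ℝ) (hθ : ∀ E u, HasDerivAt (θ E) (prF W E u (θ E u)) u)
    (h0 : ∀ E, θ E u₀ = x₀) : Continuous (fun E => θ E b) := by
  rw [continuous_iff_continuousAt]
  intro E
  obtain ⟨K, hK⟩ := exists_K W hW E u₀ b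
  have hbd : ∀ E', dist (θ E' b) (θ E b) ≤ gronwallBound 0 K (|E' - E| + 0) (b - u₀) := by
    intro E'
    refine dist_le_of_approx_trajectories_ODE_of_mem (v := prF W E) (s := fun _ => univ)
      (a := u₀) (b := b)
      (fun t ht => (prF_lipW W E t K (hK t (Ico_subset_Icc_self ht))).lipschitzOnWith)
      (f' := fun u => prF W E' u (θ E' u)) (g' := fun u => prF W E u (θ E u))
      (fun u _ => (hθ E' u).continuousAt.continuousWithinAt)
      (fun u _ => (hθ E' u).hasDerivWithinAt) ?_ (fun _ _ => trivial)
      (fun u _ => (hθ E u).continuousAt.continuousWithinAt)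
      (fun u _ => (hθ E u).hasDerivWithinAt) ?_ (fun _ _ => trivial) ?_ b ⟨hb, le_rfl⟩
    · intro u _
      rw [Real.dist_eq]
      have : prF W E' u (θ E' u) - prF W E u (θ E' u) = (E' - E) * Real.sin (θ E' u) ^ 2 := by
        unfold prF; ring
      rw [this, abs_mul, abs_of_nonneg (sq_nonneg (Real.sin _))]
      exact mul_le_of_le_one_right (abs_nonneg _) (Real.sin_sq_le_one _)
    · intro u _; simp
    · simp [h0]
  rw [ContinuousAt, tendsto_iff_dist_tendsto_zero]
  refine squeeze_zero (fun _ => dist_nonneg) hbd ?_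
  have hc : Continuous (fun E' => gronwallBound 0 K (|E' - E| + 0) (b - u₀)) :=
    (gronwallBound_continuous_ε 0 K (b - u₀)).comp (by fun_prop)
  have := hc.tendsto E
  simpa [gronwallBound_ε0_δ0] using this


lemma exists_R (W : ℝ → ℝ) (hW : Continuous W) (E : ℝ) (θ : ℝ → ℝ)
    (hθ : ∀ u, HasDerivAt θ (prF W E u (θ u)) u) :
    ∃ R : ℝ → ℝ, (∀ u, 0 < R u) ∧
      (∀ u, HasDerivAt (fun u => R u * Real.sin (θ u)) (R u * Real.cos (θ u)) u) ∧
      (∀ u, HasDerivAt (fun u => R u * Real.cos (θ u))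
        ((W u - E) * (R u * Real.sin (θ u))) u) := by
  have hcθ : Continuous θ := continuous_iff_continuousAt.mpr fun u => (hθ u).continuousAt
  have hc : Continuous (fun u => (1 + W u - E) * (Real.sin (θ u) * Real.cos (θ u))) := by fun_prop
  have hR : ∀ u, HasDerivAt (fun u => Real.exp (∫ t in (0:ℝ)..u,
      (1 + W t - E) * (Real.sin (θ t) * Real.cos (θ t))))
      (Real.exp (∫ t in (0:ℝ)..u, (1 + W t - E) * (Real.sin (θ t) * Real.cos (θ t))) *
      ((1 + W u - E) * (Real.sin (θ u) * Real.cos (θ u)))) u := fun u =>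
    (hc.integral_hasStrictDerivAt 0 u).hasDerivAt.exp
  refine ⟨fun u => Real.exp (∫ t in (0:ℝ)..u,
      (1 + W t - E) * (Real.sin (θ t) * Real.cos (θ t))), fun u => Real.exp_pos _, ?_, ?_⟩
  · intro u
    refine HasDerivAt.congr_deriv ((hR u).mul (hθ u).sin) ?_
    unfold prF
    ring
  · intro u
    refine HasDerivAt.congr_deriv ((hR u).mul (hθ u).cos) ?_
    unfold prF
    have h1 : Real.cos (θ u) ^ 2 = 1 - Real.sin (θ u) ^ 2 := by
      linarith [Real.sin_sq_add_cos_sq (θ u)]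
    beta_reduce
    generalize Real.exp (∫ t in (0:ℝ)..u, (1 + W t - E) * (Real.sin (θ t) * Real.cos (θ t))) = r
    linear_combination (r * Real.sin (θ u) * (1 + W u - E)) * h1

/-- `φ = R sin θ` and `φ' = R cos θ` solve the Schrödinger equation. -/
structure IsPr (W : ℝ → ℝ) (E : ℝ) (θ R : ℝ → ℝ) : Prop where
  hθ : ∀ u, HasDerivAt θ (prF W E u (θ u)) u
  pos : ∀ u, 0 < R u
  d1 : ∀ u, HasDerivAt (fun u => R u * Real.sin (θ u)) (R u * Real.cos (θ u)) u
  d2 : ∀ u, HasDerivAt (fun u => R u * Real.cos (θ u)) ((W u - E) * (R u * Real.sin (θ u))) u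

lemma wronskian_const (W : ℝ → ℝ) (E u₀ : ℝ) (f f1 g g1 : ℝ → ℝ)
    (hf : ∀ u, u₀ ≤ u → HasDerivAt f (f1 u) u)
    (hf1 : ∀ u, u₀ ≤ u → HasDerivAt f1 ((W u - E) * f u) u)
    (hg : ∀ u, u₀ ≤ u → HasDerivAt g (g1 u) u)
    (hg1 : ∀ u, u₀ ≤ u → HasDerivAt g1 ((W u - E) * g u) u) (u : ℝ) (hu : u₀ ≤ u) :
    f u * g1 u - f1 u * g u = f u₀ * g1 u₀ - f1 u₀ * g u₀ := by
  have hd : ∀ x, u₀ ≤ x → HasDerivAt (fun u => f u * g1 u - f1 u * g u) 0 x := by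
    intro x hx
    refine HasDerivAt.congr_deriv (((hf x hx).mul (hg1 x hx)).sub ((hf1 x hx).mul (hg x hx))) ?_
    ring
  exact constant_of_has_deriv_right_zero (f := fun u => f u * g1 u - f1 u * g u) (a := u₀) (b := u)
    (fun x hx => (hd x hx.1).continuousAt.continuousWithinAt)
    (fun x hx => (hd x hx.1).hasDerivWithinAt) u ⟨hu, le_rfl⟩

lemma IsPr.ne_zero {W : ℝ → ℝ} {E : ℝ} {θ R : ℝ → ℝ} (h : IsPr W E θ R) (a : ℝ) :
    ∃ u, a ≤ u ∧ R u * Real.sin (θ u) ≠ 0 := by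
  by_contra hcon
  push Not at hcon
  have h1 : HasDerivWithinAt (fun u => R u * Real.sin (θ u)) 0 (Ici a) a :=
    (hasDerivWithinAt_const a (Ici a) (0:ℝ)).congr (fun x hx => hcon x hx) (hcon a le_rfl)
  have h2 := (uniqueDiffOn_Ici a a self_mem_Ici).eq_deriv _ h1 (h.d1 a).hasDerivWithinAt
  have h3 := hcon a le_rfl
  have h4 := h.pos a
  have h5 := Real.sin_sq_add_cos_sq (θ a)
  have h6 : Real.sin (θ a) = 0 := by
    rcases mul_eq_zero.mp h3 with h | h
    · linarith
    · exact h
  have h7 : Real.cos (θ a) = 0 := by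
    rcases mul_eq_zero.mp h2.symm with h | h
    · linarith
    · exact h
  rw [h6, h7] at h5
  norm_num at h5

lemma ev_iff (W : ℝ → ℝ) (hW : Continuous W) (V : ℝ → ℝ) (u₀ α E : ℝ)
    (hWV : ∀ u, u₀ ≤ u → W u = V u) (θ R : ℝ → ℝ) (h : IsPr W E θ R) (h0 : θ u₀ = -α) :
    E ∈ evSet α u₀ V ↔ IntegrableOn (fun u => (R u * Real.sin (θ u)) ^ 2) (Ici u₀) := by
  constructor
  · rintro ⟨ψ, hd, hdd, ⟨p, hp, hp0⟩, hinteg, hode, hbc⟩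
    obtain ⟨θ₂, h20, hθ₂⟩ := exists_theta W hW E u₀ (-α + Real.pi / 2)
    obtain ⟨R₂, hp2, hd21, hd22⟩ := exists_R W hW E θ₂ hθ₂
    have hψ : ∀ u, u₀ ≤ u → HasDerivAt ψ (deriv ψ u) u := fun u _ => (hd u).hasDerivAt
    have hψ1 : ∀ u, u₀ ≤ u → HasDerivAt (deriv ψ) ((W u - E) * ψ u) u := by
      intro u hu
      have := (hdd u).hasDerivAt
      have h2 := hode u hu
      rw [hWV u hu]
      refine this.congr_deriv ?_
      linarith
    have w1 := wronskian_const W E u₀ ψ (deriv ψ) _ _ hψ hψ1 (fun u _ => h.d1 u) (fun u _ => h.d2 u)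
    have w2 := wronskian_const W E u₀ ψ (deriv ψ) _ _ hψ hψ1 (fun u _ => hd21 u) (fun u _ => hd22 u)
    have w3 := wronskian_const W E u₀ _ _ _ _ (fun u _ => h.d1 u) (fun u _ => h.d2 u)
      (fun u _ => hd21 u) (fun u _ => hd22 u)
    have e1 : ψ u₀ * (R u₀ * Real.cos (θ u₀)) - deriv ψ u₀ * (R u₀ * Real.sin (θ u₀)) = 0 := by
      rw [h0, Real.cos_neg, Real.sin_neg]
      linear_combination (R u₀) * hbc
    have e3 : R u₀ * Real.sin (θ u₀) * (R₂ u₀ * Real.cos (θ₂ u₀)) -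
        R u₀ * Real.cos (θ u₀) * (R₂ u₀ * Real.sin (θ₂ u₀)) = - (R u₀ * R₂ u₀) := by
      rw [h0, h20, Real.cos_add_pi_div_two, Real.sin_add_pi_div_two]
      linear_combination (- R u₀ * R₂ u₀) * Real.sin_sq_add_cos_sq (-α)
    rw [e1] at w1
    rw [e3] at w3
    have hd0 : R u₀ * R₂ u₀ ≠ 0 := (mul_pos (h.pos u₀) (hp2 u₀)).ne'
    set c := ψ u₀ * (R₂ u₀ * Real.cos (θ₂ u₀)) - deriv ψ u₀ * (R₂ u₀ * Real.sin (θ₂ u₀)) with hc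
    have key : ∀ u, u₀ ≤ u → ψ u * (-(R u₀ * R₂ u₀)) = R u * Real.sin (θ u) * c := by
      intro u hu
      rw [← w3 u hu, ← w2 u hu]
      linear_combination (-(R₂ u * Real.sin (θ₂ u))) * w1 u hu
    have hc0 : c ≠ 0 := by
      intro hc0
      have := key p hp
      rw [hc0, mul_zero] at this
      rcases mul_eq_zero.mp this with h | h
      · exact hp0 h
      · exact hd0 (by linarith)
    have hi := hinteg.const_mul ((R u₀ * R₂ u₀ / c) ^ 2)
    refine IntegrableOn.congr_fun hi ?_ measurableSet_Ici
    intro u hu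
    have := key u hu
    have h8 : R u * Real.sin (θ u) = - (R u₀ * R₂ u₀ / c) * ψ u := by
      field_simp
      linarith
    simp only
    rw [h8]; ring
  · intro hinteg
    have e1 : deriv (fun u => R u * Real.sin (θ u)) = fun u => R u * Real.cos (θ u) :=
      funext fun u => (h.d1 u).deriv
    refine ⟨fun u => R u * Real.sin (θ u), fun u => (h.d1 u).differentiableAt, ?_, h.ne_zero u₀,
      hinteg, ?_, ?_⟩
    · rw [e1]; exact fun u => (h.d2 u).differentiableAt
    · intro u hu
      rw [e1, (h.d2 u).deriv, hWV u hu]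
      ring
    · rw [e1]
      simp only
      rw [h0, Real.cos_neg, Real.sin_neg]
      ring

lemma not_integrable_of_ge (f : ℝ → ℝ) (u₀ b c : ℝ) (hc : 0 < c) (hb : u₀ ≤ b)
    (hf : ∀ u, b ≤ u → c ≤ f u) : ¬ IntegrableOn f (Ici u₀) := by
  intro hi
  have h1 : IntegrableOn f (Ici b) := hi.mono_set (Ici_subset_Ici.mpr hb)
  have h2 : IntegrableOn (fun _ => c) (Ici b) := by
    refine Integrable.mono h1 aestronglyMeasurable_const ?_
    rw [ae_restrict_iff' measurableSet_Ici]
    refine Eventually.of_forall fun u hu => ?_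
    have := hf u hu
    rw [Real.norm_eq_abs, Real.norm_eq_abs, abs_of_pos hc, abs_of_pos (by linarith)]
    exact this
  rw [integrableOn_const_iff] at h2
  rcases h2 with h2 | h2
  · exact hc.ne' (by simpa using h2)
  · simp at h2

lemma sin_mul_cos_shift (x : ℝ) (k : ℤ) :
    Real.sin x * Real.cos x = Real.sin (x - k * Real.pi) * Real.cos (x - k * Real.pi) := by
  have h1 : Real.sin (2 * x) = Real.sin (2 * (x - k * Real.pi)) := by
    rw [show 2 * (x - k * Real.pi) = 2 * x - k * (2 * Real.pi) by ring,
      Real.sin_sub_int_mul_two_pi]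
  rw [Real.sin_two_mul, Real.sin_two_mul] at h1
  linarith

lemma sc_nonneg (x : ℝ) (k : ℤ) (h1 : k * Real.pi ≤ x) (h2 : x ≤ k * Real.pi + Real.pi / 2) :
    0 ≤ Real.sin x * Real.cos x := by
  rw [sin_mul_cos_shift x k]
  apply mul_nonneg
  · apply Real.sin_nonneg_of_nonneg_of_le_pi <;> linarith [Real.pi_pos]
  · apply Real.cos_nonneg_of_neg_pi_div_two_le_of_le <;> linarith [Real.pi_pos]

lemma sc_nonpos (x : ℝ) (k : ℤ) (h1 : k * Real.pi + Real.pi / 2 ≤ x)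
    (h2 : x ≤ k * Real.pi + Real.pi) :
    Real.sin x * Real.cos x ≤ 0 := by
  rw [sin_mul_cos_shift x k]
  apply mul_nonpos_of_nonneg_of_nonpos
  · apply Real.sin_nonneg_of_nonneg_of_le_pi <;> linarith [Real.pi_pos]
  · apply Real.cos_nonpos_of_pi_div_two_le_of_le <;> linarith [Real.pi_pos]

lemma floor_pi (x : ℝ) : ⌊x / Real.pi⌋ * Real.pi ≤ x ∧ x < ⌊x / Real.pi⌋ * Real.pi + Real.pi := by
  have h1 := Int.floor_le (x / Real.pi)
  have h2 := Int.lt_floor_add_one (x / Real.pi)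
  rw [le_div_iff₀ Real.pi_pos] at h1
  rw [div_lt_iff₀ Real.pi_pos] at h2
  exact ⟨h1, by linarith⟩

lemma sc_nonneg_cell (x : ℝ) (h : 0 ≤ Real.sin x * Real.cos x) :
    ∃ k : ℤ, k * Real.pi ≤ x ∧ x ≤ k * Real.pi + Real.pi / 2 := by
  obtain ⟨h1, h2⟩ := floor_pi x
  refine ⟨⌊x / Real.pi⌋, h1, ?_⟩
  by_contra h3
  push Not at h3
  rw [sin_mul_cos_shift x ⌊x / Real.pi⌋] at h
  have h4 : 0 < Real.sin (x - ⌊x / Real.pi⌋ * Real.pi) := by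
    apply Real.sin_pos_of_pos_of_lt_pi <;> linarith [Real.pi_pos]
  have h5 : Real.cos (x - ⌊x / Real.pi⌋ * Real.pi) < 0 := by
    apply Real.cos_neg_of_pi_div_two_lt_of_lt <;> linarith [Real.pi_pos]
  nlinarith

lemma sc_neg_cell (x : ℝ) (h : Real.sin x * Real.cos x < 0) :
    ⌊x / Real.pi⌋ * Real.pi + Real.pi / 2 < x := by
  by_contra hcon
  push Not at hcon
  have := sc_nonneg x _ (floor_pi x).1 hcon
  linarith

/-- At an eigenvalue, `φ φ' < 0` in the classically forbidden region. -/
lemma eig_neg (W : ℝ → ℝ) (hW : Continuous W) (u₀ a E : ℝ) (θ R : ℝ → ℝ) (h : IsPr W E θ R)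
    (ha : u₀ ≤ a) (hE : ∀ u, a ≤ u → E ≤ W u)
    (hinteg : IntegrableOn (fun u => (R u * Real.sin (θ u)) ^ 2) (Ici u₀)) (u : ℝ) (hu : a ≤ u) :
    Real.sin (θ u) * Real.cos (θ u) < 0 := by
  by_contra hcon
  push Not at hcon
  obtain ⟨k, hk1, hk2⟩ := sc_nonneg_cell _ hcon
  have hsc : ∀ w, u ≤ w → 0 ≤ Real.sin (θ w) * Real.cos (θ w) := by
    intro w hw
    apply sc_nonneg _ k
    · exact theta_lower W hW E u w hw θ h.hθ k hk1
    · exact theta_upper W hW E u w hw θ h.hθ (fun x hx => hE x (hu.trans hx.1)) k hk2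
  have hd : ∀ w, HasDerivAt (fun u => (R u * Real.sin (θ u)) ^ 2)
      (2 * (R w * Real.sin (θ w)) * (R w * Real.cos (θ w))) w := by
    intro w
    refine HasDerivAt.congr_deriv ((h.d1 w).pow 2) ?_
    norm_num
  have hmono : MonotoneOn (fun u => (R u * Real.sin (θ u)) ^ 2) (Ici u) := by
    apply monotoneOn_of_deriv_nonneg (convex_Ici u)
    · exact fun w _ => (hd w).continuousAt.continuousWithinAt
    · exact fun w _ => (hd w).differentiableAt.differentiableWithinAt
    · intro w hw
      rw [interior_Ici] at hw
      rw [(hd w).deriv]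
      have := hsc w (le_of_lt hw)
      have h2 : 2 * (R w * Real.sin (θ w)) * (R w * Real.cos (θ w)) =
        2 * R w ^ 2 * (Real.sin (θ w) * Real.cos (θ w)) := by ring
      rw [h2]; positivity
  obtain ⟨b, hb, hb0⟩ := h.ne_zero u
  refine not_integrable_of_ge _ u₀ b ((R b * Real.sin (θ b)) ^ 2) (by positivity)
    (ha.trans (hu.trans hb)) ?_ hinteg
  intro w hw
  exact hmono hb (hb.trans hw : u ≤ w) hw

lemma eig_of_trap (W : ℝ → ℝ) (u₀ a E : ℝ) (θ R : ℝ → ℝ) (h : IsPr W E θ R)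
    (ha : u₀ ≤ a) (hE : ∀ u, a ≤ u → E + 1 ≤ W u)
    (hsc : ∀ u, a ≤ u → Real.sin (θ u) * Real.cos (θ u) ≤ 0) :
    IntegrableOn (fun u => (R u * Real.sin (θ u)) ^ 2) (Ici u₀) := by
  have hcφ : Continuous (fun u => R u * Real.sin (θ u)) :=
    continuous_iff_continuousAt.mpr fun u => (h.d1 u).continuousAt
  have hcφ2 : Continuous (fun u => (R u * Real.sin (θ u)) ^ 2) := hcφ.pow 2
  have hcφ1 : Continuous (fun u => R u * Real.cos (θ u)) :=
    continuous_iff_continuousAt.mpr fun u => (h.d2 u).continuousAt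
  have hinteg : IntegrableOn (fun u => (R u * Real.sin (θ u)) ^ 2) (Ioi a) := by
    apply integrableOn_Ioi_of_intervalIntegral_norm_bounded
      (-(R a * Real.sin (θ a) * (R a * Real.cos (θ a)))) a (b := fun x : ℝ => x) (l := atTop)
    · intro x
      exact (hcφ2.continuousOn.integrableOn_Icc).mono_set Ioc_subset_Icc_self
    · exact tendsto_id
    · filter_upwards [eventually_ge_atTop a] with x hx
      have hd : ∀ u, HasDerivAt (fun u => (R u * Real.sin (θ u)) * (R u * Real.cos (θ u)))
          ((R u * Real.cos (θ u)) * (R u * Real.cos (θ u)) +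
            (R u * Real.sin (θ u)) * ((W u - E) * (R u * Real.sin (θ u)))) u :=
        fun u => (h.d1 u).mul (h.d2 u)
      have hmono : MonotoneOn (fun u => (R u * Real.sin (θ u)) * (R u * Real.cos (θ u)) -
          ∫ t in a..u, (R t * Real.sin (θ t)) ^ 2) (Icc a x) := by
        have hd2 : ∀ u, HasDerivAt (fun u => (R u * Real.sin (θ u)) * (R u * Real.cos (θ u)) -
          ∫ t in a..u, (R t * Real.sin (θ t)) ^ 2) _ u := fun u =>
          (hd u).sub (hcφ2.integral_hasStrictDerivAt a u).hasDerivAt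
        apply monotoneOn_of_deriv_nonneg (convex_Icc a x)
        · exact fun w _ => (hd2 w).continuousAt.continuousWithinAt
        · exact fun w _ => (hd2 w).differentiableAt.differentiableWithinAt
        · intro w hw
          rw [interior_Icc] at hw
          rw [(hd2 w).deriv]
          have h1 := hE w hw.1.le
          nlinarith [sq_nonneg (R w * Real.cos (θ w)), mul_nonneg (by linarith : 0 ≤ W w - E - 1)
            (sq_nonneg (R w * Real.sin (θ w)))]
      have h3 := hmono (left_mem_Icc.mpr hx) (right_mem_Icc.mpr hx) hx
      simp only [intervalIntegral.integral_same, sub_zero] at h3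
      have h4 : (R x * Real.sin (θ x)) * (R x * Real.cos (θ x)) ≤ 0 := by
        have h2 : (R x * Real.sin (θ x)) * (R x * Real.cos (θ x)) =
          R x ^ 2 * (Real.sin (θ x) * Real.cos (θ x)) := by ring
        rw [h2]
        exact mul_nonpos_of_nonneg_of_nonpos (sq_nonneg _) (hsc x hx)
      simp only [norm_pow, Real.norm_eq_abs, sq_abs]
      linarith
  have : Ici u₀ ⊆ Icc u₀ a ∪ Ioi a := by
    intro x hx
    rcases le_or_gt x a with h | h
    · exact Or.inl ⟨hx, h⟩
    · exact Or.inr h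
  exact ((hcφ2.continuousOn.integrableOn_Icc).union hinteg).mono_set this

lemma sin_mul_sin_shift (x y : ℝ) (k : ℤ) :
    Real.sin x * Real.sin y = Real.sin (x - k * Real.pi) * Real.sin (y - k * Real.pi) := by
  rw [Real.sin_sub, Real.sin_sub, Real.sin_int_mul_pi]
  have h : Real.cos (k * Real.pi) ^ 2 = 1 := by
    have := Real.sin_sq_add_cos_sq (k * Real.pi)
    rw [Real.sin_int_mul_pi] at this; linarith
  linear_combination (-(Real.sin x * Real.sin y)) * h

lemma antitone_sq (f f' : ℝ → ℝ) (a : ℝ) (hd : ∀ u, HasDerivAt f (f' u) u)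
    (h : ∀ u, a ≤ u → f u * f' u ≤ 0) (u : ℝ) (hu : a ≤ u) : f u ^ 2 ≤ f a ^ 2 := by
  have hd2 : ∀ w, HasDerivAt (fun u => f u ^ 2) (2 * f w * f' w) w := by
    intro w
    refine HasDerivAt.congr_deriv ((hd w).pow 2) ?_
    norm_num
  have hanti : AntitoneOn (fun u => f u ^ 2) (Ici a) := by
    apply antitoneOn_of_deriv_nonpos (convex_Ici a)
    · exact fun w _ => (hd2 w).continuousAt.continuousWithinAt
    · exact fun w _ => (hd2 w).differentiableAt.differentiableWithinAt
    · intro w hw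
      rw [interior_Ici] at hw
      rw [(hd2 w).deriv]
      have := h w (le_of_lt hw)
      linarith
  exact hanti self_mem_Ici hu hu

/-- Two different eigenvalues cannot lie in the same cell. -/
lemma eig_inj (W : ℝ → ℝ) (u₀ a E E' : ℝ) (hEE : E < E')
    (θ R θ' R' : ℝ → ℝ) (h : IsPr W E θ R) (h' : IsPr W E' θ' R')
    (ha : u₀ ≤ a) (hE' : ∀ u, a ≤ u → E' ≤ W u)
    (hinteg : IntegrableOn (fun u => (R u * Real.sin (θ u)) ^ 2) (Ici u₀))
    (hinteg' : IntegrableOn (fun u => (R' u * Real.sin (θ' u)) ^ 2) (Ici u₀))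
    (hsc : ∀ u, a ≤ u → Real.sin (θ u) * Real.cos (θ u) < 0)
    (hsc' : ∀ u, a ≤ u → Real.sin (θ' u) * Real.cos (θ' u) < 0)
    (hle : θ a ≤ θ' a) (hfl : ⌊θ a / Real.pi⌋ = ⌊θ' a / Real.pi⌋) : False := by
  have hs1 : ∀ u, a ≤ u → R u * Real.sin (θ u) * (R u * Real.cos (θ u)) < 0 := by
    intro u hu
    have h2 : (R u * Real.sin (θ u)) * (R u * Real.cos (θ u)) =
          R u ^ 2 * (Real.sin (θ u) * Real.cos (θ u)) := by ring
    rw [h2]; exact mul_neg_of_pos_of_neg (pow_pos (h.pos u) 2) (hsc u hu)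
  have hs1' : ∀ u, a ≤ u → R' u * Real.sin (θ' u) * (R' u * Real.cos (θ' u)) < 0 := by
    intro u hu
    have h2 : (R' u * Real.sin (θ' u)) * (R' u * Real.cos (θ' u)) =
          R' u ^ 2 * (Real.sin (θ' u) * Real.cos (θ' u)) := by ring
    rw [h2]; exact mul_neg_of_pos_of_neg (pow_pos (h'.pos u) 2) (hsc' u hu)
  have hpa : 0 < Real.sin (θ a) * Real.sin (θ' a) := by
    rw [sin_mul_sin_shift _ _ ⌊θ a / Real.pi⌋]
    have f1 := floor_pi (θ a)
    have f2 := floor_pi (θ' a)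
    have f3 := sc_neg_cell _ (hsc a le_rfl)
    have f4 := sc_neg_cell _ (hsc' a le_rfl)
    rw [← hfl] at f2 f4
    apply mul_pos <;> apply Real.sin_pos_of_pos_of_lt_pi <;> linarith [Real.pi_pos]
  have hd0 : Real.sin (θ a - θ' a) ≤ 0 := by
    have f1 := floor_pi (θ a)
    have f2 := floor_pi (θ' a)
    rw [← hfl] at f2
    apply Real.sin_nonpos_of_nonpos_of_neg_pi_le <;> linarith [Real.pi_pos]
  set φ := fun u => R u * Real.sin (θ u) with hφ
  set φ1 := fun u => R u * Real.cos (θ u) with hφ1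
  set χ := fun u => R' u * Real.sin (θ' u) with hχ
  set χ1 := fun u => R' u * Real.cos (θ' u) with hχ1
  have hcφ : Continuous φ := continuous_iff_continuousAt.mpr fun u => (h.d1 u).continuousAt
  have hcχ : Continuous χ := continuous_iff_continuousAt.mpr fun u => (h'.d1 u).continuousAt
  have hpos : ∀ u, a ≤ u → 0 < φ u * χ u := by
    intro u hu
    by_contra hcon
    push Not at hcon
    have h0 : 0 ≤ φ a * χ a := by
      have : φ a * χ a = R a * R' a * (Real.sin (θ a) * Real.sin (θ' a)) := by
        simp only [hφ, hχ]; ring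
      rw [this]
      exact (mul_pos (mul_pos (h.pos a) (h'.pos a)) hpa).le
    have hc : ContinuousOn (fun u => φ u * χ u) (Icc a u) := (hcφ.mul hcχ).continuousOn
    obtain ⟨x, hx, hx0⟩ := intermediate_value_Icc' hu hc ⟨hcon, h0⟩
    simp only at hx0
    have n1 : φ x ≠ 0 := by
      intro hz
      have := hs1 x hx.1
      change φ x * φ1 x < 0 at this
      rw [hz] at this; simp at this
    have n2 : χ x ≠ 0 := by
      intro hz
      have := hs1' x hx.1
      change χ x * χ1 x < 0 at this
      rw [hz] at this; simp at this
    exact mul_ne_zero n1 n2 hx0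
  have hdd : ∀ u, HasDerivAt (fun u => χ1 u * φ u - φ1 u * χ u) ((E - E') * (φ u * χ u)) u := by
    intro u
    refine HasDerivAt.congr_deriv (((h'.d2 u).mul (h.d1 u)).sub ((h.d2 u).mul (h'.d1 u))) ?_
    simp only [hφ, hχ]
    ring
  have hanti : StrictAntiOn (fun u => χ1 u * φ u - φ1 u * χ u) (Ici a) := by
    apply strictAntiOn_of_deriv_neg (convex_Ici a)
    · exact fun w _ => (hdd w).continuousAt.continuousWithinAt
    · intro w hw
      rw [interior_Ici] at hw
      rw [(hdd w).deriv]
      exact mul_neg_of_neg_of_pos (by linarith) (hpos w (le_of_lt hw))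
  have hda : χ1 a * φ a - φ1 a * χ a ≤ 0 := by
    have : χ1 a * φ a - φ1 a * χ a = R a * R' a * Real.sin (θ a - θ' a) := by
      rw [Real.sin_sub]; simp only [hφ, hχ, hφ1, hχ1]; ring
    rw [this]
    exact mul_nonpos_of_nonneg_of_nonpos (mul_pos (h.pos a) (h'.pos a)).le hd0
  have hdb : χ1 (a+1) * φ (a+1) - φ1 (a+1) * χ (a+1) < 0 :=
    lt_of_lt_of_le (hanti self_mem_Ici (by simp : a + 1 ∈ Ici a) (by linarith)) hda
  set δ := χ1 (a+1) * φ (a+1) - φ1 (a+1) * χ (a+1) with hδ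
  have hde : ∀ u, a + 1 ≤ u → χ1 u * φ u - φ1 u * χ u ≤ δ := by
    intro u hu
    exact hanti.antitoneOn (by simp : a + 1 ∈ Ici a) (by simp; linarith : u ∈ Ici a) hu
  have hb1 : ∀ u, a ≤ u → φ1 u ^ 2 ≤ φ1 a ^ 2 := by
    intro u hu
    refine antitone_sq φ1 _ a h.d2 ?_ u hu
    intro w hw
    have q1 := hs1 w hw
    have q2 := hE' w hw
    change φ w * φ1 w < 0 at q1
    change φ1 w * ((W w - E) * φ w) ≤ 0
    nlinarith
  have hb2 : ∀ u, a ≤ u → χ1 u ^ 2 ≤ χ1 a ^ 2 := by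
    intro u hu
    refine antitone_sq χ1 _ a h'.d2 ?_ u hu
    intro w hw
    have q1 := hs1' w hw
    have q2 := hE' w hw
    change χ w * χ1 w < 0 at q1
    change χ1 w * ((W w - E') * χ w) ≤ 0
    nlinarith
  have hi : IntegrableOn (fun u => 2 * χ1 a ^ 2 * φ u ^ 2 + 2 * φ1 a ^ 2 * χ u ^ 2) (Ici u₀) :=
    (hinteg.const_mul (2 * χ1 a ^ 2)).add (hinteg'.const_mul (2 * φ1 a ^ 2))
  refine not_integrable_of_ge _ u₀ (a+1) (δ ^ 2) (by nlinarith) (by linarith) ?_ hi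
  intro u hu
  have q1 := hde u hu
  have q2 : δ ^ 2 ≤ (χ1 u * φ u - φ1 u * χ u) ^ 2 := by nlinarith
  have q3 := mul_le_mul_of_nonneg_right (hb2 u (by linarith)) (sq_nonneg (φ u))
  have q4 := mul_le_mul_of_nonneg_right (hb1 u (by linarith)) (sq_nonneg (χ u))
  nlinarith [sq_nonneg (χ1 u * φ u + φ1 u * χ u)]


lemma exists_eig_in_cell (W : ℝ → ℝ) (hW : Continuous W) (u₀ α T a E₀ : ℝ) (hα0 : 0 ≤ α)
    (θ : ℝ → ℝ → ℝ) (hθ : ∀ E u, HasDerivAt (θ E) (prF W E u (θ E u)) u)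
    (h0 : ∀ E, θ E u₀ = -α) (ha : u₀ ≤ a) (hWT : ∀ u, a ≤ u → T ≤ W u)
    (hE₀ : ∀ u, u₀ ≤ u → E₀ ≤ W u) (hE₀T : E₀ ≤ T)
    (k : ℤ) (hk1 : 1 ≤ k) (hk2 : k * Real.pi + Real.pi < θ T a) :
    ∃ E, E < T ∧ ∀ u, a ≤ u →
      k * Real.pi + Real.pi / 2 ≤ θ E u ∧ θ E u ≤ k * Real.pi + Real.pi := by
  have hk1' : (1:ℝ) ≤ k := by exact_mod_cast hk1
  have hpi := Real.pi_pos
  have hcont : ∀ u, u₀ ≤ u → Continuous (fun E => θ E u) := fun u hu =>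
    theta_cont W hW u₀ (-α) u hu θ hθ h0
  set A : Set ℝ := {E | ∃ u, a ≤ u ∧ k * Real.pi + Real.pi < θ E u} with hA
  set B : Set ℝ := {E | ∃ u, a ≤ u ∧ θ E u < k * Real.pi + Real.pi / 2} with hB
  have hAo : IsOpen A := by
    have : A = ⋃ u ∈ Ici a, {E | k * Real.pi + Real.pi < θ E u} := by
      ext E; simp [hA]
    rw [this]
    exact isOpen_biUnion fun u hu => isOpen_lt continuous_const (hcont u (ha.trans hu))
  have hBo : IsOpen B := by
    have : B = ⋃ u ∈ Ici a, {E | θ E u < k * Real.pi + Real.pi / 2} := by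
      ext E; simp [hB]
    rw [this]
    exact isOpen_biUnion fun u hu => isOpen_lt (hcont u (ha.trans hu)) continuous_const
  have hTA : T ∈ A := ⟨a, le_rfl, hk2⟩
  have hEB : E₀ ∈ B := by
    refine ⟨a, le_rfl, ?_⟩
    have h1 : θ E₀ u₀ ≤ ((0:ℤ):ℝ) * Real.pi + Real.pi / 2 := by rw [h0]; push_cast; linarith
    have h2 := theta_upper W hW E₀ u₀ a ha (θ E₀) (hθ E₀) (fun u hu => hE₀ u hu.1) 0 h1
    push_cast at h2
    nlinarith
  by_contra hcon
  push Not at hcon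
  have hcov : Icc E₀ T ⊆ A ∪ B := by
    intro E hE
    rcases eq_or_lt_of_le hE.2 with h | h
    · left; rw [h]; exact hTA
    · obtain ⟨u, hu, hu2⟩ := hcon E h
      by_cases h3 : k * Real.pi + Real.pi / 2 ≤ θ E u
      · left; exact ⟨u, hu, hu2 h3⟩
      · right; exact ⟨u, hu, not_le.mp h3⟩
  obtain ⟨E, hEI, ⟨u, hu, huA⟩, ⟨w, hw, hwB⟩⟩ :=
    isPreconnected_Icc A B hAo hBo hcov ⟨T, ⟨hE₀T, le_rfl⟩, hTA⟩ ⟨E₀, ⟨le_rfl, hE₀T⟩, hEB⟩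
  rcases le_total u w with h | h
  · have := theta_lower W hW E u w h (θ E) (hθ E) (k + 1) (by push_cast; linarith)
    push_cast at this
    linarith
  · have := theta_upper W hW E w u h (θ E) (hθ E)
      (fun x hx => hEI.2.trans (hWT x (hw.trans hx.1))) k hwB.le
    linarith

lemma count_lemma (W : ℝ → ℝ) (hW : Continuous W) (V : ℝ → ℝ) (u₀ α T a E₀ : ℝ)
    (hWV : ∀ u, u₀ ≤ u → W u = V u) (hα0 : 0 ≤ α) (hα1 : α < 2 * Real.pi)
    (θ : ℝ → ℝ → ℝ) (hθ : ∀ E u, HasDerivAt (θ E) (prF W E u (θ E u)) u)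
    (h0 : ∀ E, θ E u₀ = -α) (ha : u₀ ≤ a) (hWT : ∀ u, a ≤ u → T ≤ W u)
    (hE₀ : ∀ u, u₀ ≤ u → E₀ ≤ W u) (hE₀T : E₀ ≤ T) (htop : Tendsto W atTop atTop) :
    (evSet α u₀ V ∩ Iio T).Finite ∧
      |((evSet α u₀ V ∩ Iio T).ncard : ℝ) - θ T a / Real.pi| ≤ 3 := by
  have hpi := Real.pi_pos
  have hR : ∀ E, ∃ R, IsPr W E (θ E) R := by
    intro E
    obtain ⟨R, h1, h2, h3⟩ := exists_R W hW E (θ E) (hθ E)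
    exact ⟨R, ⟨hθ E, h1, h2, h3⟩⟩
  choose R hR using hR
  have hev : ∀ E, E ∈ evSet α u₀ V ↔
      IntegrableOn (fun u => (R E u * Real.sin (θ E u)) ^ 2) (Ici u₀) := fun E =>
    ev_iff W hW V u₀ α E hWV (θ E) (R E) (hR E) (h0 E)
  have hsc : ∀ E ∈ evSet α u₀ V ∩ Iio T, ∀ u, a ≤ u →
      Real.sin (θ E u) * Real.cos (θ E u) < 0 := by
    rintro E ⟨hE1, hE2⟩
    exact eig_neg W hW u₀ a E (θ E) (R E) (hR E) ha
      (fun u hu => (le_of_lt hE2).trans (hWT u hu)) ((hev E).mp hE1)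
  have haux : ∀ E ∈ evSet α u₀ V ∩ Iio T, ∀ E' ∈ evSet α u₀ V ∩ Iio T, E < E' →
      ⌊θ E a / Real.pi⌋ = ⌊θ E' a / Real.pi⌋ → False := by
    intro E hE E' hE' hlt hfl
    exact eig_inj W u₀ a E E' hlt (θ E) (R E) (θ E') (R E') (hR E) (hR E') ha
      (fun u hu => (le_of_lt hE'.2).trans (hWT u hu)) ((hev E).mp hE.1) ((hev E').mp hE'.1)
      (hsc E hE) (hsc E' hE')
      (theta_mono W hW E E' u₀ a ha hlt.le (θ E) (θ E') (hθ E) (hθ E') (by rw [h0, h0])) hfl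
  have hinj : InjOn (fun E => ⌊θ E a / Real.pi⌋) (evSet α u₀ V ∩ Iio T) := by
    intro E hE E' hE' hfl
    rcases lt_trichotomy E E' with h | h | h
    · exact (haux E hE E' hE' h hfl).elim
    · exact h
    · exact (haux E' hE' E hE h hfl.symm).elim
  have hlow : ∀ E, -2 ≤ ⌊θ E a / Real.pi⌋ := by
    intro E
    rw [Int.le_floor, le_div_iff₀ hpi]
    exact theta_lower W hW E u₀ a ha (θ E) (hθ E) (-2) (by rw [h0]; push_cast; linarith)
  have hmaps : ∀ E ∈ evSet α u₀ V ∩ Iio T,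
      (fun E => ⌊θ E a / Real.pi⌋) E ∈ Icc (-2 : ℤ) ⌊θ T a / Real.pi⌋ := by
    intro E hE
    refine ⟨hlow E, Int.floor_mono ?_⟩
    have := theta_mono W hW E T u₀ a ha (le_of_lt hE.2) (θ E) (θ T) (hθ E) (hθ T) (by rw [h0, h0])
    exact div_le_div_of_nonneg_right this hpi.le
  have hfin : (evSet α u₀ V ∩ Iio T).Finite := Set.Finite.of_injOn hmaps hinj (finite_Icc _ _)
  refine ⟨hfin, ?_⟩
  have hup : ((evSet α u₀ V ∩ Iio T).ncard : ℝ) ≤ θ T a / Real.pi + 3 := by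
    have h1 := Set.ncard_le_ncard_of_injOn _ hmaps hinj (finite_Icc _ _)
    rw [← Finset.coe_Icc, Set.ncard_coe_finset, Int.card_Icc] at h1
    have h2 := hlow T
    have h3 : ((evSet α u₀ V ∩ Iio T).ncard : ℤ) ≤ ⌊θ T a / Real.pi⌋ + 3 := by omega
    have h4 : ((evSet α u₀ V ∩ Iio T).ncard : ℝ) ≤ ⌊θ T a / Real.pi⌋ + 3 := by exact_mod_cast h3
    linarith [Int.floor_le (θ T a / Real.pi)]
  have hex : ∀ k : ℤ, k ∈ Icc (1:ℤ) (⌈θ T a / Real.pi⌉ - 2) → ∃ E ∈ evSet α u₀ V ∩ Iio T,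
      k * Real.pi + Real.pi / 2 ≤ θ E a ∧ θ E a ≤ k * Real.pi + Real.pi := by
    intro k hk
    have hk2 : k * Real.pi + Real.pi < θ T a := by
      have h1 := Int.ceil_lt_add_one (θ T a / Real.pi)
      have h2 : ((k + 2 : ℤ) : ℝ) ≤ ⌈θ T a / Real.pi⌉ := by
        exact_mod_cast (by linarith [hk.2] : k + 2 ≤ ⌈θ T a / Real.pi⌉)
      push_cast at h2
      have h3 : (k:ℝ) + 1 < θ T a / Real.pi := by linarith
      rw [lt_div_iff₀ hpi] at h3
      linarith
    obtain ⟨E, hET, hE⟩ := exists_eig_in_cell W hW u₀ α T a E₀ hα0 θ hθ h0 ha hWT hE₀ hE₀T k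
      hk.1 hk2
    refine ⟨E, ⟨?_, hET⟩, hE a le_rfl⟩
    rw [hev]
    obtain ⟨b, hb⟩ := (tendsto_atTop.mp htop (E + 1)).exists_forall_of_atTop
    refine eig_of_trap W u₀ (max a b) E (θ E) (R E) (hR E) (ha.trans (le_max_left _ _))
      (fun u hu => hb u ((le_max_right _ _).trans hu)) ?_
    intro u hu
    have := hE u ((le_max_left _ _).trans hu)
    exact sc_nonpos _ k this.1 this.2
  choose! e he1 he2 using hex
  have hdown : θ T a / Real.pi - 2 ≤ ((evSet α u₀ V ∩ Iio T).ncard : ℝ) := by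
    have hinj2 : InjOn e (Icc (1:ℤ) (⌈θ T a / Real.pi⌉ - 2)) := by
      intro k hk l hl hkl
      have h1 := he2 k hk
      have h2 := he2 l hl
      rw [hkl] at h1
      by_contra hne
      rcases lt_or_gt_of_ne hne with h | h
      · have h3 : (k:ℝ) + 1 ≤ l := by exact_mod_cast h
        nlinarith
      · have h3 : (l:ℝ) + 1 ≤ k := by exact_mod_cast h
        nlinarith
    have h1 := Set.ncard_le_ncard_of_injOn e he1 hinj2 hfin
    rw [← Finset.coe_Icc, Set.ncard_coe_finset, Int.card_Icc] at h1
    have h3 : ⌈θ T a / Real.pi⌉ - 2 ≤ ((evSet α u₀ V ∩ Iio T).ncard : ℤ) := by omega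
    have h4 : (⌈θ T a / Real.pi⌉ : ℝ) - 2 ≤ ((evSet α u₀ V ∩ Iio T).ncard : ℝ) := by
      exact_mod_cast h3
    linarith [Int.le_ceil (θ T a / Real.pi)]
  rw [abs_le]
  constructor <;> linarith


/-- The rescaled Prüfer angle: a continuous branch of `arctan (κ tan x)`. -/
noncomputable def prG (κ x : ℝ) : ℝ :=
  x + Real.arctan ((κ - 1) * (Real.sin x * Real.cos x) / (1 + (κ - 1) * Real.sin x ^ 2))

lemma prG_near (κ x : ℝ) : |prG κ x - x| ≤ Real.pi / 2 := by
  unfold prG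
  rw [add_sub_cancel_left, abs_le]
  exact ⟨(Real.neg_pi_div_two_lt_arctan _).le, (Real.arctan_lt_pi_div_two _).le⟩

lemma den_pos (q x : ℝ) (hq : 0 < q) : 0 < 1 + (q - 1) * Real.sin x ^ 2 := by
  have h1 := Real.sin_sq_le_one x
  have h2 := sq_nonneg (Real.sin x)
  rcases le_total q 1 with h | h
  · nlinarith
  · nlinarith

lemma prG_deriv (κ θ : ℝ → ℝ) (κ' θ' u : ℝ) (hκ : HasDerivAt κ κ' u) (hθ : HasDerivAt θ θ' u)
    (hpos : 0 < κ u) :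
    HasDerivAt (fun u => prG (κ u) (θ u))
      ((κ u * θ' + κ' * (Real.sin (θ u) * Real.cos (θ u))) /
        (1 + (κ u ^ 2 - 1) * Real.sin (θ u) ^ 2)) u := by
  have hP := den_pos (κ u) (θ u) hpos
  have hD := den_pos (κ u ^ 2) (θ u) (by positivity)
  have h1 := ((hκ.sub_const 1).mul (hθ.sin.mul hθ.cos)).div
    (((hκ.sub_const 1).mul (hθ.sin.pow 2)).const_add 1) hP.ne'
  have h2 := hθ.add h1.arctan
  refine HasDerivAt.congr_deriv h2 ?_
  have hc : Real.cos (θ u) ^ 2 = 1 - Real.sin (θ u) ^ 2 := by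
    linarith [Real.sin_sq_add_cos_sq (θ u)]
  have hT : 1 + ((κ u - 1) * (Real.sin (θ u) * Real.cos (θ u)) /
      (1 + (κ u - 1) * Real.sin (θ u) ^ 2)) ^ 2 =
      (1 + (κ u ^ 2 - 1) * Real.sin (θ u) ^ 2) / (1 + (κ u - 1) * Real.sin (θ u) ^ 2) ^ 2 := by
    field_simp
    linear_combination ((κ u - 1) ^ 2 * Real.sin (θ u) ^ 2) * hc
  simp only [Pi.mul_apply, Pi.pow_apply, Pi.div_apply, Pi.add_apply]
  rw [hT]
  generalize Real.sin (θ u) = s at *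
  generalize Real.cos (θ u) = c at *
  generalize κ u = k at *
  rw [eq_div_iff hD.ne', one_div_div, div_mul_div_comm, add_mul]
  rw [mul_comm (_ ^ 2) (_ : ℝ), mul_comm (1 + (k ^ 2 - 1) * s ^ 2) ((1 + (k - 1) * s ^ 2) ^ 2)]
  have hP2 : (1 + (k - 1) * s ^ 2) ^ 2 ≠ 0 := by positivity
  rw [mul_comm _ ((1 + (k - 1) * s ^ 2) ^ 2), mul_div_mul_left _ _ hP2,
    div_mul_cancel₀ _ hD.ne']
  norm_num
  linear_combination ((k - 1) * θ' * (1 - (k - 1) * s ^ 2)) * hc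

lemma abs_sc_le (κ x : ℝ) (hκ : 0 < κ) :
    |2 * κ * (Real.sin x * Real.cos x) / (1 + (κ ^ 2 - 1) * Real.sin x ^ 2)| ≤ 1 := by
  have hD := den_pos (κ ^ 2) x (by positivity)
  rw [abs_div, abs_of_pos hD, div_le_one hD]
  have hc := Real.sin_sq_add_cos_sq x
  rw [abs_le]
  constructor
  · nlinarith [sq_nonneg (κ * Real.sin x + Real.cos x)]
  · nlinarith [sq_nonneg (κ * Real.sin x - Real.cos x)]

/-- A function whose increments are of second order with respect to a monotone one is antitone. -/
lemma incr_le (f g : ℝ → ℝ) (a b L : ℝ) (hab : a ≤ b)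
    (h : ∀ x ∈ Icc a b, ∀ y ∈ Icc a b, x ≤ y → f y - f x ≤ (g y - g x) * L * (y - x)) :
    f b ≤ f a := by
  have key : ∀ n : ℕ, f b - f a ≤ (g b - g a) * L * (b - a) * (1 / ((n:ℝ) + 1)) := by
    intro n
    set t : ℕ → ℝ := fun i => a + i * ((b - a) / (n + 1)) with ht
    have hn : (0:ℝ) < n + 1 := by positivity
    have hstep : 0 ≤ (b - a) / ((n:ℝ) + 1) := div_nonneg (by linarith) hn.le
    have htm : ∀ i ≤ n + 1, t i ∈ Icc a b := by
      intro i hi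
      have hi' : (i:ℝ) ≤ n + 1 := by exact_mod_cast hi
      constructor
      · simp only [ht]; have : 0 ≤ (i:ℝ) * ((b - a) / (n + 1)) := by positivity
        linarith
      · simp only [ht]
        have : (i:ℝ) * ((b - a) / (n + 1)) ≤ (n + 1) * ((b - a) / (n + 1)) := by gcongr
        rw [mul_div_cancel₀ _ hn.ne'] at this
        linarith
    have hdiff : ∀ i, t (i+1) - t i = (b - a) / (n + 1) := by
      intro i; simp only [ht]; push_cast; ring
    have h0 : t 0 = a := by simp [ht]
    have h1 : t (n+1) = b := by
      simp only [ht]; push_cast; rw [mul_div_cancel₀ _ hn.ne']; ring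
    have hs1 := Finset.sum_range_sub (fun i => f (t i)) (n+1)
    have hs2 := Finset.sum_range_sub (fun i => g (t i)) (n+1)
    rw [h0, h1] at hs1 hs2
    rw [← hs1, ← hs2, Finset.sum_mul, Finset.sum_mul, Finset.sum_mul]
    apply Finset.sum_le_sum
    intro i hi
    have hi := Finset.mem_range.mp hi
    have := h (t i) (htm i hi.le) (t (i+1)) (htm (i+1) hi) (by linarith [hdiff i])
    rw [hdiff] at this
    calc _ ≤ _ := this
      _ = _ := by ring
  have hlim : Tendsto (fun n : ℕ => (g b - g a) * L * (b - a) * (1 / ((n:ℝ) + 1))) atTop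
      (𝓝 ((g b - g a) * L * (b - a) * 0)) :=
    tendsto_one_div_add_atTop_nhds_zero_nat.const_mul _
  have := ge_of_tendsto' hlim key
  linarith

/-- A form of the second mean value theorem. -/
lemma second_mvt (g K K' : ℝ → ℝ) (a b : ℝ) (hab : a ≤ b) (hg : MonotoneOn g (Icc a b))
    (hgc : ContinuousOn g (Icc a b)) (hga : 0 ≤ g a)
    (hK : ∀ u ∈ Icc a b, HasDerivAt K (K' u) u) (hKc : ContinuousOn K' (Icc a b))
    (hK0 : ∀ u ∈ Icc a b, 0 ≤ K u) (hK1 : ∀ u ∈ Icc a b, K u ≤ 1) :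
    |∫ u in a..b, g u * K' u| ≤ g b := by
  obtain ⟨L, hL⟩ := isCompact_Icc.exists_bound_of_continuousOn hKc
  have hii : ∀ x ∈ Icc a b, ∀ y ∈ Icc a b, IntervalIntegrable (fun u => g u * K' u) volume x y := by
    intro x hx y hy
    exact ((hgc.mul hKc).mono (uIcc_subset_Icc hx hy)).intervalIntegrable
  have hiK : ∀ x ∈ Icc a b, ∀ y ∈ Icc a b, IntervalIntegrable K' volume x y := by
    intro x hx y hy
    exact (hKc.mono (uIcc_subset_Icc hx hy)).intervalIntegrable
  have hloc : ∀ x ∈ Icc a b, ∀ y ∈ Icc a b, x ≤ y →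
      |(∫ u in a..y, g u * K' u) - (∫ u in a..x, g u * K' u) - g y * (K y - K x)| ≤
        (g y - g x) * L * (y - x) := by
    intro x hx y hy hxy
    have ha : a ∈ Icc a b := left_mem_Icc.mpr hab
    rw [intervalIntegral.integral_interval_sub_left (hii a ha y hy) (hii a ha x hx)]
    have hftc : ∫ u in x..y, K' u = K y - K x :=
      intervalIntegral.integral_eq_sub_of_hasDerivAt
        (fun u hu => hK u (uIcc_subset_Icc hx hy hu)) (hiK x hx y hy)
    rw [← hftc, ← intervalIntegral.integral_const_mul,
      ← intervalIntegral.integral_sub (hii x hx y hy) ((hiK x hx y hy).const_mul _)]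
    have hb := intervalIntegral.norm_integral_le_of_norm_le_const (a := x) (b := y)
      (f := fun u => g u * K' u - g y * K' u) (C := (g y - g x) * L) ?_
    · rw [abs_of_nonneg (by linarith : 0 ≤ y - x)] at hb
      exact hb
    · intro u hu
      rw [uIoc_of_le hxy] at hu
      have hu' : u ∈ Icc a b := ⟨hx.1.trans hu.1.le, hu.2.trans hy.2⟩
      rw [← sub_mul, norm_mul]
      have h1 := hg hx hu' hu.1.le
      have h2 := hg hu' hy hu.2
      have h3 := hL u hu'
      rw [Real.norm_eq_abs, abs_sub_comm, abs_of_nonneg (by linarith)]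
      exact mul_le_mul (by linarith) h3 (norm_nonneg _) (by linarith)
  have ha : a ∈ Icc a b := left_mem_Icc.mpr hab
  have hb : b ∈ Icc a b := right_mem_Icc.mpr hab
  have hgb : g a ≤ g b := hg ha hb hab
  have h1 := incr_le (fun x => (∫ u in a..x, g u * K' u) - g x * K x) g a b L hab (by
    intro x hx y hy hxy
    have h2 := (abs_le.mp (hloc x hx y hy hxy)).2
    have h3 := mul_nonneg (sub_nonneg.mpr (hg hx hy hxy)) (hK0 x hx)
    linarith)
  have h2 := incr_le (fun x => -((∫ u in a..x, g u * K' u) - g x * K x + g x)) g a b L hab (by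
    intro x hx y hy hxy
    have h2 := (abs_le.mp (hloc x hx y hy hxy)).1
    have h3 := mul_nonneg (sub_nonneg.mpr (hg hx hy hxy)) (sub_nonneg.mpr (hK1 x hx))
    linarith)
  simp only [intervalIntegral.integral_same] at h1 h2
  have e1 := mul_nonneg hga (hK0 a ha)
  have e2 := mul_nonneg (hga.trans hgb) (sub_nonneg.mpr (hK1 b hb))
  have e3 := mul_nonneg (hga.trans hgb) (hK0 b hb)
  have e4 := mul_nonneg hga (sub_nonneg.mpr (hK1 a ha))
  rw [abs_le]
  constructor <;> linarith


/-- The sine of twice the rescaled angle. -/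
noncomputable def prS (W θ : ℝ → ℝ) (T u : ℝ) : ℝ :=
  2 * Real.sqrt (T - W u) * (Real.sin (θ u) * Real.cos (θ u)) /
    (1 + (T - W u - 1) * Real.sin (θ u) ^ 2)

lemma prS_le (W θ : ℝ → ℝ) (T u : ℝ) (h : W u < T) : |prS W θ T u| ≤ 1 := by
  have h1 := abs_sc_le (Real.sqrt (T - W u)) (θ u) (Real.sqrt_pos.mpr (by linarith))
  rw [Real.sq_sqrt (by linarith)] at h1
  exact h1

lemma prS_cont (W θ : ℝ → ℝ) (T a b : ℝ) (hW : Continuous W) (hθ : Continuous θ)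
    (h : ∀ u ∈ Icc a b, W u < T) : ContinuousOn (prS W θ T) (Icc a b) := by
  unfold prS
  apply ContinuousOn.div
  · fun_prop
  · fun_prop
  · intro u hu
    exact (den_pos (T - W u) (θ u) (by linarith [h u hu])).ne'

lemma eta_deriv (W v θ : ℝ → ℝ) (T u : ℝ) (hW : HasDerivAt W (v u) u)
    (hθ : HasDerivAt θ (prF W T u (θ u)) u) (h : W u < T) :
    HasDerivAt (fun u => prG (Real.sqrt (T - W u)) (θ u))
      (Real.sqrt (T - W u) - v u / (4 * (T - W u)) * prS W θ T u) u := by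
  have hQ : 0 < T - W u := by linarith
  have hk := (hW.const_sub T).sqrt hQ.ne'
  have h1 := prG_deriv (fun u => Real.sqrt (T - W u)) θ _ _ u hk hθ (Real.sqrt_pos.mpr hQ)
  refine HasDerivAt.congr_deriv h1 ?_
  have hD := den_pos (T - W u) (θ u) hQ
  have hs := Real.sq_sqrt hQ.le
  have hp := Real.sqrt_pos.mpr hQ
  unfold prF prS
  generalize Real.sqrt (T - W u) = k at *
  rw [← hs] at hD ⊢
  field_simp
  ring

lemma eta_ftc (W v θ : ℝ → ℝ) (T a b : ℝ) (hab : a ≤ b) (hW : ∀ u, HasDerivAt W (v u) u)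
    (hv : Continuous v)
    (hθ : ∀ u, HasDerivAt θ (prF W T u (θ u)) u) (h : ∀ u ∈ Icc a b, W u < T) :
    prG (Real.sqrt (T - W b)) (θ b) - prG (Real.sqrt (T - W a)) (θ a)
      - (∫ u in a..b, Real.sqrt (T - W u)) = - ∫ u in a..b, v u / (4 * (T - W u)) * prS W θ T u := by
  have hWc : Continuous W := continuous_iff_continuousAt.mpr fun u => (hW u).continuousAt
  have hθc : Continuous θ := continuous_iff_continuousAt.mpr fun u => (hθ u).continuousAt
  have hc1 : ContinuousOn (fun u => v u / (4 * (T - W u)) * prS W θ T u) (Icc a b) := by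
    refine ContinuousOn.mul (ContinuousOn.div (by fun_prop) (by fun_prop) ?_)
      (prS_cont W θ T a b hWc hθc h)
    intro u hu
    have := h u hu
    exact (by linarith : 0 < 4 * (T - W u)).ne'
  have hc0 : Continuous (fun u => Real.sqrt (T - W u)) := by fun_prop
  rw [← uIcc_of_le hab] at hc1
  have := intervalIntegral.integral_eq_sub_of_hasDerivAt
    (f := fun u => prG (Real.sqrt (T - W u)) (θ u)) (a := a) (b := b)
    (fun u hu => eta_deriv W v θ T u (hW u) (hθ u) (h u (by rwa [uIcc_of_le hab] at hu)))
    ((hc0.intervalIntegrable _ _).sub hc1.intervalIntegrable)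
  rw [intervalIntegral.integral_sub (hc0.intervalIntegrable _ _) hc1.intervalIntegrable] at this
  linarith

lemma first_part (W v θ : ℝ → ℝ) (T a b M : ℝ) (hab : a ≤ b) (hW : ∀ u, HasDerivAt W (v u) u)
    (hv : Continuous v)
    (hθ : ∀ u, HasDerivAt θ (prF W T u (θ u)) u) (h : ∀ u ∈ Icc a b, W u + 1 ≤ T)
    (hM : ∀ u ∈ Icc a b, |v u| ≤ M) :
    |prG (Real.sqrt (T - W b)) (θ b) - prG (Real.sqrt (T - W a)) (θ a)
      - (∫ u in a..b, Real.sqrt (T - W u))| ≤ M * (b - a) := by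
  rw [eta_ftc W v θ T a b hab hW hv hθ (fun u hu => by linarith [h u hu]), abs_neg]
  have := intervalIntegral.norm_integral_le_of_norm_le_const (a := a) (b := b)
      (f := fun u => v u / (4 * (T - W u)) * prS W θ T u) (C := M) ?_
  · rwa [abs_of_nonneg (by linarith : 0 ≤ b - a)] at this
  · intro u hu
    rw [uIoc_of_le hab] at hu
    have hu' : u ∈ Icc a b := Ioc_subset_Icc_self hu
    have h1 := h u hu'
    have h2 := hM u hu'
    have h3 := prS_le W θ T u (by linarith)
    rw [Real.norm_eq_abs, abs_mul, abs_div, abs_of_pos (by linarith : 0 < 4 * (T - W u))]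
    have h4 : |v u| / (4 * (T - W u)) ≤ M := by
      rw [div_le_iff₀ (by linarith)]
      nlinarith [abs_nonneg (v u)]
    nlinarith [abs_nonneg (prS W θ T u), (abs_nonneg (v u)).trans h2]

lemma K_deriv (W v θ : ℝ → ℝ) (T u : ℝ) (hW : HasDerivAt W (v u) u)
    (hθ : HasDerivAt θ (prF W T u (θ u)) u) (h : W u < T) :
    HasDerivAt (fun u => (T - W u) * Real.sin (θ u) ^ 2 / (1 + (T - W u - 1) * Real.sin (θ u) ^ 2))
      (prS W θ T u * (Real.sqrt (T - W u) - v u / (4 * (T - W u)) * prS W θ T u)) u := by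
  have hQ : 0 < T - W u := by linarith
  have hD := den_pos (T - W u) (θ u) hQ
  have h1 := ((hW.const_sub T).mul (hθ.sin.pow 2)).div
    ((((hW.const_sub T).sub_const 1).mul (hθ.sin.pow 2)).const_add 1) hD.ne'
  refine HasDerivAt.congr_deriv h1 ?_
  have hs := Real.sq_sqrt hQ.le
  have hp := Real.sqrt_pos.mpr hQ
  have hc : Real.cos (θ u) ^ 2 = 1 - Real.sin (θ u) ^ 2 := by
    linarith [Real.sin_sq_add_cos_sq (θ u)]
  simp only [Pi.mul_apply, Pi.pow_apply, Pi.div_apply]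
  unfold prF prS
  generalize Real.sqrt (T - W u) = k at *
  rw [← hs] at hD ⊢
  generalize Real.sin (θ u) = s at *
  generalize Real.cos (θ u) = c at *
  generalize v u = w at *
  have e : 2 * k * (s * c) / (1 + (k ^ 2 - 1) * s ^ 2) *
      (k - w / (4 * k ^ 2) * (2 * k * (s * c) / (1 + (k ^ 2 - 1) * s ^ 2))) =
      (2 * k ^ 2 * (s * c) * (1 + (k ^ 2 - 1) * s ^ 2) - w * (s ^ 2 * c ^ 2)) /
        (1 + (k ^ 2 - 1) * s ^ 2) ^ 2 := by
    generalize (1 + (k ^ 2 - 1) * s ^ 2) = D at *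
    field_simp
    ring
  rw [e]
  congr 1
  norm_num
  linear_combination (w * s ^ 2) * hc

lemma mid_part (W v θ : ℝ → ℝ) (T a b : ℝ) (hab : a ≤ b) (hW : ∀ u, HasDerivAt W (v u) u)
    (hv : Continuous v)
    (hθ : ∀ u, HasDerivAt θ (prF W T u (θ u)) u) (h : ∀ u ∈ Icc a b, W u < T)
    (hv0 : ∀ u ∈ Icc a b, 0 ≤ v u) (hvm : MonotoneOn v (Icc a b))
    (hb : v b ≤ 2 * Real.sqrt (T - W b) ^ 3) :
    |prG (Real.sqrt (T - W b)) (θ b) - prG (Real.sqrt (T - W a)) (θ a)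
      - (∫ u in a..b, Real.sqrt (T - W u))| ≤ 1 := by
  have hWc : Continuous W := continuous_iff_continuousAt.mpr fun u => (hW u).continuousAt
  have hθc : Continuous θ := continuous_iff_continuousAt.mpr fun u => (hθ u).continuousAt
  have hSc := prS_cont W θ T a b hWc hθc h
  have hkp : ∀ u ∈ Icc a b, 0 < Real.sqrt (T - W u) := fun u hu =>
    Real.sqrt_pos.mpr (by linarith [h u hu])
  have hk2 : ∀ u ∈ Icc a b, Real.sqrt (T - W u) ^ 2 = T - W u := fun u hu =>
    Real.sq_sqrt (by linarith [h u hu])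
  have hbm : b ∈ Icc a b := right_mem_Icc.mpr hab
  have ham : a ∈ Icc a b := left_mem_Icc.mpr hab
  have hWm : MonotoneOn W (Icc a b) := by
    apply monotoneOn_of_deriv_nonneg (convex_Icc a b) hWc.continuousOn
    · exact fun u _ => (hW u).differentiableAt.differentiableWithinAt
    · intro u hu
      rw [(hW u).deriv]
      exact hv0 u (interior_subset hu)
  set g : ℝ → ℝ := fun u => v u / (4 * Real.sqrt (T - W u) ^ 3) with hg
  have hgc : ContinuousOn g (Icc a b) := by
    refine ContinuousOn.div (by fun_prop) (by fun_prop) ?_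
    intro u hu
    have := hkp u hu
    positivity
  have hg0 : ∀ u ∈ Icc a b, 0 ≤ g u := fun u hu => by
    have := hkp u hu
    have := hv0 u hu
    simp only [hg]
    positivity
  have hgm : MonotoneOn g (Icc a b) := by
    intro x hx y hy hxy
    have h1 := hkp y hy
    have h2 : Real.sqrt (T - W y) ≤ Real.sqrt (T - W x) :=
      Real.sqrt_le_sqrt (by linarith [hWm hx hy hxy])
    exact div_le_div₀ (hv0 y hy) (hvm hx hy hxy) (by positivity) (by gcongr)
  have hgb : g b ≤ 1 / 2 := by
    have := hkp b hbm
    simp only [hg]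
    rw [div_le_iff₀ (by positivity)]
    linarith
  set K' : ℝ → ℝ := fun u =>
    prS W θ T u * (Real.sqrt (T - W u) - v u / (4 * (T - W u)) * prS W θ T u) with hK'
  have hK'c : ContinuousOn K' (Icc a b) := by
    refine hSc.mul (ContinuousOn.sub (by fun_prop) (ContinuousOn.mul
      (ContinuousOn.div (by fun_prop) (by fun_prop) ?_) hSc))
    intro u hu
    exact (by linarith [h u hu] : 0 < 4 * (T - W u)).ne'
  have hmvt := second_mvt g (fun u => (T - W u) * Real.sin (θ u) ^ 2 /
      (1 + (T - W u - 1) * Real.sin (θ u) ^ 2)) K' a b hab hgm hgc (hg0 a ham)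
    (fun u hu => K_deriv W v θ T u (hW u) (hθ u) (h u hu)) hK'c
    (fun u hu => by
      have := den_pos (T - W u) (θ u) (by linarith [h u hu])
      have h2 : 0 < T - W u := by linarith [h u hu]
      positivity)
    (fun u hu => by
      have := den_pos (T - W u) (θ u) (by linarith [h u hu])
      rw [div_le_one this]
      nlinarith [Real.sin_sq_le_one (θ u)])
  have hsplit : ∀ u ∈ Icc a b, v u / (4 * (T - W u)) * prS W θ T u =
      g u * K' u + g u ^ 2 * Real.sqrt (T - W u) * prS W θ T u ^ 2 := by
    intro u hu
    have h1 := hkp u hu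
    simp only [hg, hK']
    rw [← hk2 u hu]
    rw [Real.sqrt_sq h1.le]
    field_simp
    ring
  -- the second term
  have hc2 : ContinuousOn (fun u => g u ^ 2 * Real.sqrt (T - W u) * prS W θ T u ^ 2) (Icc a b) := by
    have : ContinuousOn (fun u => Real.sqrt (T - W u)) (Icc a b) := by fun_prop
    exact ((hgc.pow 2).mul this).mul (hSc.pow 2)
  have hc1 : ContinuousOn (fun u => g u * K' u) (Icc a b) := hgc.mul hK'c
  have hkd : ∀ u ∈ Icc a b, HasDerivAt (fun u => (Real.sqrt (T - W u) ^ 3)⁻¹)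
      (3 * v u / (2 * Real.sqrt (T - W u) ^ 5)) u := by
    intro u hu
    have h1 := hkp u hu
    have hk := (((hW u).const_sub T).sqrt (by linarith [h u hu])).pow 3
    have hk := hk.inv (by simp only [Pi.pow_apply]; positivity)
    refine HasDerivAt.congr_deriv hk ?_
    simp only [Pi.pow_apply]
    generalize Real.sqrt (T - W u) = k at *
    field_simp
    norm_num
    try ring
  have hcd : ContinuousOn (fun u => 3 * v u / (2 * Real.sqrt (T - W u) ^ 5)) (Icc a b) := by
    refine ContinuousOn.div (by fun_prop) (by fun_prop) ?_
    intro u hu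
    have := hkp u hu
    positivity
  have hinteg : ∫ u in a..b, 3 * v u / (2 * Real.sqrt (T - W u) ^ 5) =
      (Real.sqrt (T - W b) ^ 3)⁻¹ - (Real.sqrt (T - W a) ^ 3)⁻¹ := by
    rw [← uIcc_of_le hab] at hkd hcd
    exact intervalIntegral.integral_eq_sub_of_hasDerivAt hkd hcd.intervalIntegrable
  have hi1 : IntervalIntegrable (fun u => g u * K' u) volume a b := by
    rw [← uIcc_of_le hab] at hc1; exact hc1.intervalIntegrable
  have hi2 : IntervalIntegrable (fun u => g u ^ 2 * Real.sqrt (T - W u) * prS W θ T u ^ 2)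
      volume a b := by
    rw [← uIcc_of_le hab] at hc2; exact hc2.intervalIntegrable
  have hid : IntervalIntegrable (fun u => 3 * v u / (2 * Real.sqrt (T - W u) ^ 5))
      volume a b := by
    rw [← uIcc_of_le hab] at hcd; exact hcd.intervalIntegrable
  have hle2 : ∫ u in a..b, g u ^ 2 * Real.sqrt (T - W u) * prS W θ T u ^ 2 ≤ 1 / 2 := by
    have h1 : ∫ u in a..b, g u ^ 2 * Real.sqrt (T - W u) * prS W θ T u ^ 2 ≤
        ∫ u in a..b, (v b / 24) * (3 * v u / (2 * Real.sqrt (T - W u) ^ 5)) := by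
      apply intervalIntegral.integral_mono_on hab hi2 (hid.const_mul _)
      intro u hu
      have h1 := hkp u hu
      have h2 : prS W θ T u ^ 2 ≤ 1 := by
        rw [sq_le_one_iff_abs_le_one]; exact prS_le W θ T u (h u hu)
      have h3 := hvm hu hbm hu.2
      have h4 := hv0 u hu
      have h5 : g u ^ 2 * Real.sqrt (T - W u) = (v u * v u) / (16 * Real.sqrt (T - W u) ^ 5) := by
        simp only [hg]
        field_simp
        norm_num
      calc _ ≤ g u ^ 2 * Real.sqrt (T - W u) * 1 := by gcongr
        _ = (v u * v u) / (16 * Real.sqrt (T - W u) ^ 5) := by rw [mul_one, h5]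
        _ ≤ (v b * v u) / (16 * Real.sqrt (T - W u) ^ 5) := by gcongr
        _ = _ := by field_simp; ring
    rw [intervalIntegral.integral_const_mul, hinteg] at h1
    have hkb := hkp b hbm
    have hka := hkp a ham
    have h2 : 0 < (Real.sqrt (T - W a) ^ 3)⁻¹ := by positivity
    have h3 : v b / 24 * (Real.sqrt (T - W b) ^ 3)⁻¹ ≤ 1 / 2 := by
      rw [← div_eq_mul_inv, div_le_iff₀ (by positivity)]
      have : 0 < Real.sqrt (T - W b) ^ 3 := by positivity
      linarith
    nlinarith [hv0 b hbm]
  have hge2 : 0 ≤ ∫ u in a..b, g u ^ 2 * Real.sqrt (T - W u) * prS W θ T u ^ 2 :=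
    intervalIntegral.integral_nonneg hab fun u _ => by positivity
  rw [eta_ftc W v θ T a b hab hW hv hθ h, abs_neg]
  rw [intervalIntegral.integral_congr (g := fun u => g u * K' u +
    g u ^ 2 * Real.sqrt (T - W u) * prS W θ T u ^ 2) (by
      intro u hu
      rw [uIcc_of_le hab] at hu
      exact hsplit u hu), intervalIntegral.integral_add hi1 hi2]
  rw [abs_le] at hmvt ⊢
  constructor <;> linarith [hmvt.1, hmvt.2]

lemma last_part (W θ : ℝ → ℝ) (T a b k : ℝ) (hab : a ≤ b) (hW : Continuous W)
    (hθ : ∀ u, HasDerivAt θ (prF W T u (θ u)) u) (hk : 0 < k)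
    (h : ∀ u ∈ Icc a b, T - W u ≤ k ^ 2) :
    θ a - Real.pi ≤ θ b ∧ θ b ≤ θ a + Real.pi + k * (b - a) := by
  constructor
  · have h1 := floor_pi (θ a)
    have h2 := theta_lower W hW T a b hab θ hθ _ h1.1
    linarith [h1.2]
  · have hd : ∀ u, HasDerivAt (fun u => prG k (θ u)) ((k * prF W T u (θ u) +
        0 * (Real.sin (θ u) * Real.cos (θ u))) /
        (1 + (k ^ 2 - 1) * Real.sin (θ u) ^ 2)) u := fun u =>
      prG_deriv (fun _ => k) θ 0 _ u (hasDerivAt_const _ _) (hθ u) hk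
    have hm := (convex_Icc a b).image_sub_le_mul_sub_of_deriv_le
      (f := fun u => prG k (θ u)) (C := k)
      (fun u _ => (hd u).continuousAt.continuousWithinAt)
      (fun u _ => (hd u).differentiableAt.differentiableWithinAt) (by
        intro u hu
        have hu := interior_subset hu
        rw [(hd u).deriv, div_le_iff₀ (den_pos _ _ (by positivity))]
        unfold prF
        have := h u hu
        have h2 : (T - W u - 1) * Real.sin (θ u) ^ 2 ≤ (k ^ 2 - 1) * Real.sin (θ u) ^ 2 := by
          gcongr
        nlinarith) a (left_mem_Icc.mpr hab) b (right_mem_Icc.mpr hab) hab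
    have h1 := abs_le.mp (prG_near k (θ a))
    have h2 := abs_le.mp (prG_near k (θ b))
    linarith [h1.1, h1.2, h2.1, h2.2]


lemma phase_est (W v θ : ℝ → ℝ) (T u₀ c b M : ℝ) (huc : u₀ ≤ c) (hcb : c ≤ b)
    (hW : ∀ u, HasDerivAt W (v u) u) (hv : Continuous v)
    (hθ : ∀ u, HasDerivAt θ (prF W T u (θ u)) u)
    (h1 : ∀ u ∈ Icc u₀ c, W u + 1 ≤ T) (hM : ∀ u ∈ Icc u₀ c, |v u| ≤ M)
    (hvm : MonotoneOn v (Ici c)) (hvc : 0 < v c) (hWb : W b = T) (hTc : v c ^ 2 ≤ T - W c) :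
    |θ b - θ u₀ - ∫ u in u₀..b, Real.sqrt (T - W u)| ≤ M * (c - u₀) + 20 := by
  have hWc : Continuous W := continuous_iff_continuousAt.mpr fun u => (hW u).continuousAt
  have hvpos : ∀ u, c ≤ u → 0 < v u := fun u hu =>
    hvc.trans_le (hvm self_mem_Ici hu hu)
  have hgrow : ∀ x y, c ≤ x → x ≤ y → v x * (y - x) ≤ W y - W x := by
    intro x y hx hxy
    apply (convex_Icc x y).mul_sub_le_image_sub_of_le_deriv hWc.continuousOn
      (fun u _ => (hW u).differentiableAt.differentiableWithinAt) _ x (left_mem_Icc.mpr hxy)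
      y (right_mem_Icc.mpr hxy) hxy
    intro u hu
    have hu := interior_subset hu
    rw [(hW u).deriv]
    exact hvm hx (hx.trans hu.1) hu.1
  have hmono : ∀ x y, c ≤ x → x ≤ y → W x ≤ W y := by
    intro x y hx hxy
    have := hgrow x y hx hxy
    have := mul_nonneg (hvpos x hx).le (sub_nonneg.mpr hxy)
    linarith
  have hQc : 1 ≤ T - W c := by linarith [h1 c (right_mem_Icc.mpr huc)]
  obtain ⟨x, hx, hx0⟩ : ∃ x ∈ Icc c b, 4 * (T - W x) ^ 3 - v x ^ 2 = 0 := by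
    have hcont : ContinuousOn (fun x => 4 * (T - W x) ^ 3 - v x ^ 2) (Icc c b) := by fun_prop
    have := intermediate_value_Icc' hcb hcont
    apply this
    constructor
    · rw [hWb]
      nlinarith [sq_nonneg (v b)]
    · have h2 : 1 ≤ (T - W c) ^ 2 := one_le_pow₀ hQc
      nlinarith
  have hvx := hvpos x hx.1
  have hQx : 0 < T - W x := by
    by_contra hn
    have h2 : (T - W x) ^ 3 ≤ 0 := by
      have h3 : 0 ≤ (T - W x) ^ 2 := sq_nonneg _
      have h4 : T - W x ≤ 0 := not_lt.mp hn
      nlinarith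
    have : 0 < v x ^ 2 := by positivity
    linarith
  have hk := Real.sqrt_pos.mpr hQx
  have hk2 := Real.sq_sqrt hQx.le
  have hvk : v x = 2 * Real.sqrt (T - W x) ^ 3 := by
    have : v x ^ 2 = (2 * Real.sqrt (T - W x) ^ 3) ^ 2 := by
      have e : (2 * Real.sqrt (T - W x) ^ 3) ^ 2 = 4 * (Real.sqrt (T - W x) ^ 2) ^ 3 := by ring
      rw [e, hk2]; linarith
    exact (sq_eq_sq₀ hvx.le (by positivity)).mp this
  have hlen : Real.sqrt (T - W x) * (b - x) ≤ 1 / 2 := by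
    have h2 := hgrow x b hx.1 hx.2
    rw [hWb, hvk] at h2
    generalize Real.sqrt (T - W x) = k at *
    rw [← hk2] at h2
    have h3 : k ^ 2 * (2 * (k * (b - x))) ≤ k ^ 2 * 1 := by linarith
    have := le_of_mul_le_mul_left h3 (by positivity)
    linarith
  have hf := first_part W v θ T u₀ c M huc hW hv hθ h1 hM
  have hm := mid_part W v θ T c x hx.1 hW hv hθ
    (fun u hu => by linarith [hmono u x hu.1 hu.2]) (fun u hu => (hvpos u hu.1).le)
    (hvm.mono Icc_subset_Ici_self) hvk.le
  have hl := last_part W θ T x b _ hx.2 hWc hθ hk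
    (fun u hu => by rw [hk2]; linarith [hmono x u hx.1 hu.1])
  have hi : ∀ p q, IntervalIntegrable (fun u => Real.sqrt (T - W u)) volume p q := fun p q =>
    (by fun_prop : Continuous (fun u => Real.sqrt (T - W u))).intervalIntegrable _ _
  have hadd1 := intervalIntegral.integral_add_adjacent_intervals (hi u₀ c) (hi c x)
  have hadd2 := intervalIntegral.integral_add_adjacent_intervals (hi u₀ x) (hi x b)
  have hI0 : 0 ≤ ∫ u in x..b, Real.sqrt (T - W u) :=
    intervalIntegral.integral_nonneg hx.2 fun u _ => Real.sqrt_nonneg _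
  have hI1 : ∫ u in x..b, Real.sqrt (T - W u) ≤ Real.sqrt (T - W x) * (b - x) := by
    have := intervalIntegral.integral_mono_on hx.2 (hi x b)
      (_root_.intervalIntegrable_const (c := Real.sqrt (T - W x)))
      (fun u hu => Real.sqrt_le_sqrt (by linarith [hmono x u hx.1 hu.1]))
    rw [intervalIntegral.integral_const, smul_eq_mul] at this
    linarith
  have hn1 := abs_le.mp (prG_near (Real.sqrt (T - W x)) (θ x))
  have hn2 := abs_le.mp (prG_near (Real.sqrt (T - W u₀)) (θ u₀))
  have hpi := Real.pi_lt_four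
  rw [abs_le] at hf hm ⊢
  constructor <;> linarith [hf.1, hf.2, hm.1, hm.2, hl.1, hl.2, hn1.1, hn1.2, hn2.1, hn2.2]

lemma exists_ext (V : ℝ → ℝ) (u₀ : ℝ) (hV : ContDiffOn ℝ 1 V (Ici u₀)) :
    ∃ W v : ℝ → ℝ, Continuous v ∧ (∀ u, HasDerivAt W (v u) u) ∧ ∀ u, u₀ ≤ u → W u = V u := by
  have hud := uniqueDiffOn_Ici u₀
  have hd : ContinuousOn (derivWithin V (Ici u₀)) (Ici u₀) :=
    hV.continuousOn_derivWithin hud le_rfl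
  set v : ℝ → ℝ := fun u => derivWithin V (Ici u₀) (max u u₀) with hvdef
  have hv : Continuous v := hd.comp_continuous (by fun_prop) (fun u => mem_Ici.mpr (le_max_right u u₀))
  refine ⟨fun u => V u₀ + ∫ t in u₀..u, v t, v, hv, ?_, ?_⟩
  · intro u
    exact (intervalIntegral.integral_hasDerivAt_right (hv.intervalIntegrable _ _)
      (hv.stronglyMeasurableAtFilter _ _) hv.continuousAt).const_add _
  · intro u hu
    have hdiff : DifferentiableOn ℝ V (Ici u₀) := hV.differentiableOn one_ne_zero
    have := intervalIntegral.integral_eq_sub_of_hasDerivAt_of_le hu (f := V) (f' := v)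
      (hV.continuousOn.mono Icc_subset_Ici_self) (by
        intro x hx
        have h1 := (hdiff x hx.1.le).hasDerivWithinAt.hasDerivAt (Ici_mem_nhds hx.1)
        simp only [hvdef, max_eq_left hx.1.le]
        exact h1) (hv.intervalIntegrable _ _)
    simp only [this]
    ring

theorem main_thm (u₀ α : ℝ) (hα0 : 0 ≤ α) (hα1 : α < 2 * Real.pi) (V : ℝ → ℝ)
    (hV : ContDiffOn ℝ 1 V (Set.Ici u₀))
    (hmono : ∃ u₁ : ℝ, u₀ ≤ u₁ ∧ StrictMonoOn V (Set.Ici u₁) ∧ ConvexOn ℝ (Set.Ici u₁) V) :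
    ∃ T₁ C : ℝ, 0 < C ∧ ∀ T : ℝ, T₁ ≤ T →
      ∃ uT : ℝ, (u₀ ≤ uT ∧ V uT = T ∧ ∀ u : ℝ, u₀ ≤ u → u < uT → V u < T) ∧
        (∀ u' : ℝ, (u₀ ≤ u' ∧ V u' = T ∧ ∀ u : ℝ, u₀ ≤ u → u < u' → V u < T) → u' = uT) ∧
        (evSet α u₀ V ∩ Set.Iio T).Finite ∧
        |((evSet α u₀ V ∩ Set.Iio T).ncard : ℝ) -
          (1/Real.pi) * ∫ u in u₀..uT, Real.sqrt (T - V u)| ≤ C := by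
  obtain ⟨W, v, hv, hW, hWV⟩ := exists_ext V u₀ hV
  obtain ⟨u₁, hu01, hsm, hcx⟩ := hmono
  have hWc : Continuous W := continuous_iff_continuousAt.mpr fun u => (hW u).continuousAt
  have hWV1 : EqOn V W (Ici u₁) := fun u hu => (hWV u (hu01.trans hu)).symm
  have hsmW : StrictMonoOn W (Ici u₁) := hsm.congr hWV1
  have hcxW : ConvexOn ℝ (Ici u₁) W := hcx.congr hWV1
  have hvm1 : MonotoneOn v (Ici u₁) := by
    have := hcxW.monotoneOn_deriv (fun x _ => (hW x).differentiableAt)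
    have e : deriv W = v := funext fun u => (hW u).deriv
    rwa [e] at this
  set c := u₁ + 1 with hc
  have hu1c : u₁ ≤ c := by linarith
  have huc : u₀ ≤ c := by linarith
  have hvm : MonotoneOn v (Ici c) := hvm1.mono (Ici_subset_Ici.mpr hu1c)
  have hvc : 0 < v c := by
    by_contra hn
    have h1 : W c - W u₁ ≤ 0 * (c - u₁) := by
      apply (convex_Icc u₁ c).image_sub_le_mul_sub_of_deriv_le hWc.continuousOn
        (fun u _ => (hW u).differentiableAt.differentiableWithinAt) _ u₁ (left_mem_Icc.mpr hu1c)
        c (right_mem_Icc.mpr hu1c) hu1c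
      intro u hu
      have hu := interior_subset hu
      rw [(hW u).deriv]
      exact (hvm1 hu.1 hu1c hu.2).trans (not_lt.mp hn)
    have h2 := hsmW (self_mem_Ici) hu1c (by linarith : u₁ < c)
    linarith
  have hgrow : ∀ y, c ≤ y → W c + v c * (y - c) ≤ W y := by
    intro y hy
    have : v c * (y - c) ≤ W y - W c := by
      apply (convex_Icc c y).mul_sub_le_image_sub_of_le_deriv hWc.continuousOn
        (fun u _ => (hW u).differentiableAt.differentiableWithinAt) _ c (left_mem_Icc.mpr hy)
        y (right_mem_Icc.mpr hy) hy
      intro u hu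
      have hu := interior_subset hu
      rw [(hW u).deriv]
      exact hvm self_mem_Ici hu.1 hu.1
    linarith
  have htop : Tendsto W atTop atTop := by
    have h1 : Tendsto (fun y => W c + v c * (y - c)) atTop atTop :=
      tendsto_atTop_add_const_left _ _
        ((tendsto_atTop_add_const_right _ (-c) tendsto_id).const_mul_atTop hvc)
    exact tendsto_atTop_mono' _ ((eventually_ge_atTop c).mono hgrow) h1
  obtain ⟨B, hB⟩ := isCompact_Icc.exists_bound_of_continuousOn
    (hWc.continuousOn (s := Icc u₀ c))
  obtain ⟨M, hM⟩ := isCompact_Icc.exists_bound_of_continuousOn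
    (hv.continuousOn (s := Icc u₀ c))
  have hB' : ∀ u ∈ Icc u₀ c, -B ≤ W u ∧ W u ≤ B := fun u hu => abs_le.mp (hB u hu)
  have hcm : c ∈ Icc u₀ c := right_mem_Icc.mpr huc
  have hB0 : 0 ≤ B := (norm_nonneg _).trans (hB c hcm)
  have hM0 : 0 ≤ M := (norm_nonneg _).trans (hM c hcm)
  have hE₀ : ∀ u, u₀ ≤ u → -B ≤ W u := by
    intro u hu
    rcases le_total u c with h | h
    · exact (hB' u ⟨hu, h⟩).1
    · have := hgrow u h
      have := mul_nonneg hvc.le (sub_nonneg.mpr h)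
      linarith [(hB' c hcm).1]
  choose θ hθ0 hθ using fun E => exists_theta W hWc E u₀ (-α)
  have hpi := Real.pi_pos
  have hCn : 0 ≤ (M * (c - u₀) + 20 + α) / Real.pi := by
    have := mul_nonneg hM0 (sub_nonneg.mpr huc)
    positivity
  refine ⟨B + 1 + v c ^ 2, 3 + (M * (c - u₀) + 20 + α) / Real.pi, by linarith, ?_⟩
  intro T hT
  have hvc2 := sq_nonneg (v c)
  have hlow : ∀ u ∈ Icc u₀ c, W u + 1 ≤ T := fun u hu => by linarith [(hB' u hu).2]
  -- the turning point
  obtain ⟨b, hb, hWb⟩ : ∃ b, c ≤ b ∧ W b = T := by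
    obtain ⟨y, hy1, hy2⟩ := ((eventually_ge_atTop c).and (htop.eventually_ge_atTop T)).exists
    obtain ⟨b, hb, hbT⟩ := intermediate_value_Icc hy1 hWc.continuousOn
      ⟨by linarith [hlow c hcm], hy2⟩
    exact ⟨b, hb.1, hbT⟩
  have hub : u₀ ≤ b := huc.trans hb
  have hbelow : ∀ u, u₀ ≤ u → u < b → W u < T := by
    intro u hu hub'
    rcases le_total u c with h | h
    · linarith [hlow u ⟨hu, h⟩]
    · rw [← hWb]; exact hsmW (hu1c.trans h) (hu1c.trans hb) hub'
  have habove : ∀ u, b ≤ u → T ≤ W u := by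
    intro u hu
    rw [← hWb]
    exact hsmW.monotoneOn (hu1c.trans hb) (hu1c.trans (hb.trans hu)) hu
  have hcount := count_lemma W hWc V u₀ α T b (-B) hWV hα0 hα1 θ hθ hθ0 hub habove hE₀
    (by linarith) htop
  have hphase := phase_est W v (θ T) T u₀ c b M huc hb hW hv (hθ T) hlow hM hvm hvc hWb
    (by linarith [(hB' c hcm).2])
  refine ⟨b, ⟨hub, by rw [← hWV b hub, hWb], fun u hu h => by
    rw [← hWV u hu]; exact hbelow u hu h⟩, ?_, hcount.1, ?_⟩
  · rintro u' ⟨h1, h2, h3⟩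
    rcases lt_trichotomy u' b with h | h | h
    · have := hbelow u' h1 h
      rw [hWV u' h1] at this
      linarith
    · exact h
    · have := h3 b hub h
      rw [← hWV b hub] at this
      linarith
  · have hI : ∫ u in u₀..b, Real.sqrt (T - V u) = ∫ u in u₀..b, Real.sqrt (T - W u) := by
      apply intervalIntegral.integral_congr
      intro u hu
      rw [uIcc_of_le hub] at hu
      simp only [hWV u hu.1]
    rw [hI]
    have h2 : |θ T b / Real.pi - (1 / Real.pi) * ∫ u in u₀..b, Real.sqrt (T - W u)| ≤
        (M * (c - u₀) + 20 + α) / Real.pi := by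
      have e : θ T b / Real.pi - (1 / Real.pi) * ∫ u in u₀..b, Real.sqrt (T - W u) =
          (θ T b - ∫ u in u₀..b, Real.sqrt (T - W u)) / Real.pi := by ring
      rw [e, abs_div, abs_of_pos hpi]
      rw [hθ0 T] at hphase
      gcongr
      rw [abs_le] at hphase ⊢
      constructor <;> linarith [hphase.1, hphase.2]
    exact (abs_sub_le _ (θ T b / Real.pi) _).trans (add_le_add hcount.2 h2)

end Helpers

/-- Weyl-type eigenvalue counting asymptotics (Titchmarsh): for a `C¹` potential on
`[u₀,∞)` that is eventually strictly increasing and convex, the number of eigenvalues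
below `T` is `(1/π)·∫_{u₀}^{u_T} √(T - V(u)) du + O(1)`. -/
theorem stmt_8 (u₀ α : ℝ) (hα0 : 0 ≤ α) (hα1 : α < 2 * Real.pi) (V : ℝ → ℝ)
    (hV : ContDiffOn ℝ 1 V (Set.Ici u₀))
    (hmono : ∃ u₁ : ℝ, u₀ ≤ u₁ ∧ StrictMonoOn V (Set.Ici u₁) ∧ ConvexOn ℝ (Set.Ici u₁) V) :
    ∃ T₁ C : ℝ, 0 < C ∧ ∀ T : ℝ, T₁ ≤ T →
      ∃ uT : ℝ, (u₀ ≤ uT ∧ V uT = T ∧ ∀ u : ℝ, u₀ ≤ u → u < uT → V u < T) ∧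
        (∀ u' : ℝ, (u₀ ≤ u' ∧ V u' = T ∧ ∀ u : ℝ, u₀ ≤ u → u < u' → V u < T) → u' = uT) ∧
        (evSet α u₀ V ∩ Set.Iio T).Finite ∧
        |((evSet α u₀ V ∩ Set.Iio T).ncard : ℝ) -
          (1/Real.pi) * ∫ u in u₀..uT, Real.sqrt (T - V u)| ≤ C := by
  exact main_thm u₀ α hα0 hα1 V hV hmono
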